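/- arXiv:2406.17139 — 5 statements merged into one kernel-verified Lean document; each statement's English description precedes it below -/
import Mathlib

section
/- Let k be a field, d ≥ 2, and let S(d) = k[x_i, y_i, z_i : 0 ≤ i ≤ d−1] with K the ideal generated by x_i y_{i+1} − y_i x_{i+1}, y_i z_{i+1} − z_i y_{i+1}, and z_i x_{i+1} for 0 ≤ i ≤ d−2. For i+j+l = d let m_{i,j,l} denote the image in S(d)/K of the monomial x_0⋯x_{i−1}·y_i⋯y_{i+j−1}·z_{i+j}⋯z_{d−1}. Then: (1) if i,j,l ≥ 1, then m_{i',j',l'}·m_{i,j,l} = 0 for all (i',j',l') with i'+j'+l' = d; (2) m_{d,0,0}·m_{0,i,d−i} = 0 for i < d and m_{d,0,0}·m_{i,0,d−i} = 0 for i ≤ d−2; (3) m_{0,d,0}·m_{i,0,d−i} = 0 for 1 ≤ i ≤ d−1; (4) m_{0,0,d}·m_{i,d−i,0} = 0 for 1 ≤ i ≤ d−1 and m_{0,0,d}·m_{i,0,d−i} = 0 for i ≥ 2; (5) for 1 ≤ i ≤ d−1, m_{i,0,d−i} annihilates m_{j,d−j,0} for j < d, m_{0,j,d−j} for j > 0,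 and m_{j,0,d−j} for j ∉ {i−1, i, i+1}; (6) if i ≥ 1 and j < d then m_{i,d−i,0}·m_{0,j,d−j} = 0. -/
/-!
Statement 9: Relations among the generators `m_{i,j,l}` of (the model of)
`U_d(A)` for `A = k⟨x,y,z⟩/⟨xy−yx, yz−zy, zx⟩`.

`S(d) = k[x_i, y_i, z_i : 0 ≤ i ≤ d−1]` is modelled as
`MvPolynomial (Fin d × Fin 3) k` with `x_i = X (i,0)`, `y_i = X (i,1)`,
`z_i = X (i,2)`, and `K` is the ideal generated by
`x_i y_{i+1} − y_i x_{i+1}`, `y_i z_{i+1} − z_i y_{i+1}`, `z_i x_{i+1}`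
for `0 ≤ i ≤ d−2`.  For `i+j+l = d`, `m_{i,j,l}` is the class in `S(d)/K` of
`x_0 ⋯ x_{i−1} · y_i ⋯ y_{i+j−1} · z_{i+j} ⋯ z_{d−1}`.
-/

open MvPolynomial

noncomputable section

variable (k : Type) [Field k] (d : ℕ)

/-- `S(d) = k[x_i, y_i, z_i : 0 ≤ i ≤ d-1]`. -/
abbrev Sd := MvPolynomial (Fin d × Fin 3) k

/-- the variable `x_i` -/
def xv (i : Fin d) : Sd k d := X (i, 0)
/-- the variable `y_i` -/
def yv (i : Fin d) : Sd k d := X (i, 1)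
/-- the variable `z_i` -/
def zv (i : Fin d) : Sd k d := X (i, 2)

/-- The multilinearization ideal `K` of the relations `xy−yx, yz−zy, zx` of `A`. -/
def KK : Ideal (Sd k d) :=
  Ideal.span {p | ∃ (i : ℕ) (h : i + 1 < d),
    p = xv k d ⟨i, by omega⟩ * yv k d ⟨i + 1, h⟩ - yv k d ⟨i, by omega⟩ * xv k d ⟨i + 1, h⟩ ∨
    p = yv k d ⟨i, by omega⟩ * zv k d ⟨i + 1, h⟩ - zv k d ⟨i, by omega⟩ * yv k d ⟨i + 1, h⟩ ∨
    p = zv k d ⟨i, by omega⟩ * xv k d ⟨i + 1, h⟩}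

/-- `m_{i,j,l}` (with `l = d - i - j` implicit): the class in `S(d)/K` of
`x_0 ⋯ x_{i−1} · y_i ⋯ y_{i+j−1} · z_{i+j} ⋯ z_{d−1}`. -/
def mm (i j : ℕ) : Sd k d ⧸ KK k d :=
  Ideal.Quotient.mk (KK k d)
    (∏ t : Fin d, if (t : ℕ) < i then xv k d t else if (t : ℕ) < i + j then yv k d t
      else zv k d t)

end

/-- The class in `S(d)/K` of the variable at position `t` with letter `c` (`0 ↦ x`, `1 ↦ y`,
`2 ↦ z`), with value `1` outside the range of positions. -/
noncomputable def letterClass (k : Type) [Field k] (d t : ℕ) (c : Fin 3) : Sd k d ⧸ KK k d :=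
  if h : t < d then Ideal.Quotient.mk (KK k d) (X (⟨t, h⟩, c)) else 1

/-- The class in `S(d)/K` of the word `L` written from position `s` onwards. -/
noncomputable def wordClass (k : Type) [Field k] (d : ℕ) : ℕ → List (Fin 3) → Sd k d ⧸ KK k d
  | _, [] => 1
  | s, c :: L => letterClass k d s c * wordClass k d (s + 1) L

section

variable {k : Type} [Field k] {d : ℕ}

theorem letterClass_x_mul_y {t : ℕ} (h : t + 1 < d) :
    letterClass k d t 0 * letterClass k d (t + 1) 1 =
      letterClass k d t 1 * letterClass k d (t + 1) 0 := by
  have h' : t < d := by omega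
  simp only [letterClass, h, h', dif_pos, ← map_mul]
  exact Ideal.Quotient.eq.2 (Ideal.subset_span ⟨t, h, Or.inl rfl⟩)

theorem letterClass_y_mul_z {t : ℕ} (h : t + 1 < d) :
    letterClass k d t 1 * letterClass k d (t + 1) 2 =
      letterClass k d t 2 * letterClass k d (t + 1) 1 := by
  have h' : t < d := by omega
  simp only [letterClass, h, h', dif_pos, ← map_mul]
  exact Ideal.Quotient.eq.2 (Ideal.subset_span ⟨t, h, Or.inr (Or.inl rfl)⟩)

theorem letterClass_z_mul_x {t : ℕ} (h : t + 1 < d) :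
    letterClass k d t 2 * letterClass k d (t + 1) 0 = 0 := by
  have h' : t < d := by omega
  simp only [letterClass, h, h', dif_pos, ← map_mul]
  exact Ideal.Quotient.eq_zero_iff_mem.2 (Ideal.subset_span ⟨t, h, Or.inr (Or.inr rfl)⟩)

theorem letterClass_y_mul_comm {t : ℕ} (h : t + 1 < d) (c : Fin 3) :
    letterClass k d t 1 * letterClass k d (t + 1) c =
      letterClass k d t c * letterClass k d (t + 1) 1 := by
  fin_cases c
  · exact (letterClass_x_mul_y h).symm
  · rfl
  · exact letterClass_y_mul_z h

theorem letterClass_z_mul_yx {t : ℕ} (h : t + 1 < d) :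
    letterClass k d (t + 1) 2 * (letterClass k d t 1 * letterClass k d (t + 1) 0) = 0 := by
  linear_combination letterClass k d (t + 1) 0 * letterClass_y_mul_z (k := k) h +
    letterClass k d (t + 1) 1 * letterClass_z_mul_x (k := k) h

theorem letterClass_x_mul_zy {t : ℕ} (h : t + 1 < d) :
    letterClass k d t 0 * (letterClass k d t 2 * letterClass k d (t + 1) 1) = 0 := by
  linear_combination letterClass k d t 2 * letterClass_x_mul_y (k := k) h +
    letterClass k d t 1 * letterClass_z_mul_x (k := k) h

theorem letterClass_yy_mul_xz {t : ℕ} (h : t + 1 < d) :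
    letterClass k d t 1 * letterClass k d (t + 1) 1 *
      (letterClass k d t 0 * letterClass k d (t + 1) 2) = 0 := by
  linear_combination
    letterClass k d t 1 * letterClass k d (t + 1) 2 * letterClass_x_mul_y (k := k) h +
    letterClass k d t 1 * letterClass_z_mul_yx (k := k) h

theorem wordClass_append (s : ℕ) (L M : List (Fin 3)) :
    wordClass k d s (L ++ M) = wordClass k d s L * wordClass k d (s + L.length) M := by
  induction L generalizing s with
  | nil => simp [wordClass]
  | cons c L ih =>
    simp only [List.cons_append, wordClass, ih, List.length_cons, mul_assoc]
    rw [show s + 1 + L.length = s + (L.length + 1) by omega]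

theorem wordClass_y_cons (L : List (Fin 3)) {s : ℕ} (h : s + L.length < d) :
    wordClass k d s (1 :: L) = wordClass k d s (L ++ [1]) := by
  induction L generalizing s with
  | nil => rfl
  | cons c L ih =>
    rw [List.length_cons] at h
    have hy := ih (s := s + 1) (by omega)
    simp only [wordClass, List.cons_append] at hy ⊢
    rw [← hy, ← mul_assoc, ← mul_assoc, letterClass_y_mul_comm (by omega)]

/-- The letter `y` can be moved to the end of a word. -/
theorem wordClass_eq_filter_append (L : List (Fin 3)) {s : ℕ} (h : s + L.length ≤ d) :
    wordClass k d s L = wordClass k d s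
      (L.filter (· ≠ 1) ++ List.replicate (L.length - (L.filter (· ≠ 1)).length) 1) := by
  induction L generalizing s with
  | nil => rfl
  | cons c L ih =>
    rw [List.length_cons] at h
    have hle := List.length_filter_le (fun c : Fin 3 => decide (c ≠ 1)) L
    by_cases hc : c = 1
    · subst hc
      have hf : (1 :: L).filter (fun c : Fin 3 => decide (c ≠ 1)) =
        L.filter (fun c : Fin 3 => decide (c ≠ 1)) := by simp
      rw [hf, List.length_cons, Nat.succ_sub hle, List.replicate_succ', ← List.append_assoc,
        ← wordClass_y_cons, wordClass, wordClass, ih (by omega)]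
      rw [List.length_append, List.length_replicate]
      omega
    · have hf : (c :: L).filter (fun c : Fin 3 => decide (c ≠ 1)) =
        c :: L.filter (fun c : Fin 3 => decide (c ≠ 1)) := by simp [hc]
      rw [hf, List.length_cons, List.length_cons, Nat.add_sub_add_right, List.cons_append,
        wordClass, wordClass, ih (by omega)]

/-- Words of the same length with the same subword of letters other than `y` have the same
class. -/
theorem wordClass_congr {L M : List (Fin 3)} (hL : L.length = d) (hM : M.length = d)
    (h : L.filter (· ≠ 1) = M.filter (· ≠ 1)) : wordClass k d 0 L = wordClass k d 0 M := by
  rw [wordClass_eq_filter_append L (by omega), wordClass_eq_filter_append M (by omega), h, hL, hM]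

theorem wordClass_replicate (s n : ℕ) (c : Fin 3) :
    wordClass k d s (List.replicate n c) = ∏ t ∈ Finset.range n, letterClass k d (s + t) c := by
  induction n generalizing s with
  | zero => rfl
  | succ n ih =>
    rw [List.replicate_succ, wordClass, ih, Finset.prod_range_succ', mul_comm]
    simp only [Nat.add_zero, Nat.add_assoc, Nat.add_comm 1]

theorem mm_eq_wordClass {i j l : ℕ} (h : i + j + l = d) :
    mm k d i j = wordClass k d 0
      (List.replicate i 0 ++ List.replicate j 1 ++ List.replicate l 2) := by
  have hprod : mm k d i j = ∏ t ∈ Finset.range d,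
      letterClass k d t (if t < i then 0 else if t < i + j then 1 else 2) := by
    rw [mm, map_prod, Finset.prod_range]
    refine Finset.prod_congr rfl fun t _ => ?_
    simp only [letterClass, t.isLt, dif_pos]
    split_ifs <;> rfl
  rw [hprod, ← h, Finset.prod_range_add, Finset.prod_range_add]
  subst h
  simp only [wordClass_append, wordClass_replicate, List.length_append, List.length_replicate,
    Nat.zero_add]
  congr 1
  · congr 1
    · refine Finset.prod_congr rfl fun t ht => ?_
      rw [if_pos (Finset.mem_range.1 ht)]
    · refine Finset.prod_congr rfl fun t ht => ?_
      have := Finset.mem_range.1 ht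
      rw [if_neg (by omega), if_pos (by omega)]
  · refine Finset.prod_congr rfl fun t ht => ?_
    rw [if_neg (by omega), if_neg (by omega)]

theorem wordClass_dvd_mm {i j l : ℕ} (h : i + j + l = d) (A C B : List (Fin 3)) {t : ℕ}
    (hA : A.length = t) (hlen : t + C.length + B.length = d)
    (hf : (A ++ C ++ B).filter (· ≠ 1) = List.replicate i 0 ++ List.replicate l 2) :
    wordClass k d t C ∣ mm k d i j := by
  rw [mm_eq_wordClass h, wordClass_congr (M := A ++ C ++ B) (by simp; omega) (by simp; omega)
    (by rw [hf]; simp [List.filter_append]), wordClass_append, wordClass_append, hA, Nat.zero_add]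
  exact (dvd_mul_left _ _).mul_right _

theorem x_dvd_mm {i j l t : ℕ} (h : i + j + l = d) (hi : 1 ≤ i) (ht : t < i + j) :
    letterClass k d t 0 ∣ mm k d i j := by
  obtain ⟨a, b, rfl, ha, hb⟩ : ∃ a b, t = a + b ∧ a + 1 ≤ i ∧ b ≤ j := by
    by_cases hti : t < i
    · exact ⟨t, 0, by omega⟩
    · exact ⟨i - 1, t - (i - 1), by omega⟩
  obtain ⟨e, rfl⟩ := Nat.exists_eq_add_of_le ha
  obtain ⟨f, rfl⟩ := Nat.exists_eq_add_of_le hb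
  have := wordClass_dvd_mm (k := k) (t := a + b) h (List.replicate a 0 ++ List.replicate b 1) [0]
    (List.replicate e 0 ++ List.replicate f 1 ++ List.replicate l 2)
    (by simp) (by simp; omega) (by simp [List.filter_append, List.replicate_add])
  simpa [wordClass] using this

theorem z_dvd_mm {i j l t : ℕ} (h : i + j + l = d) (hl : 1 ≤ l) (hi : i ≤ t) (ht : t < d) :
    letterClass k d t 2 ∣ mm k d i j := by
  obtain ⟨b, c, rfl, hb, hc⟩ : ∃ b c, t = i + b + c ∧ b ≤ j ∧ c + 1 ≤ l := by
    by_cases htj : t < i + j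
    · exact ⟨t - i, 0, by omega⟩
    · exact ⟨j, t - i - j, by omega⟩
  obtain ⟨e, rfl⟩ := Nat.exists_eq_add_of_le hb
  obtain ⟨f, rfl⟩ := Nat.exists_eq_add_of_le hc
  have := wordClass_dvd_mm (k := k) (t := i + b + c) h
    (List.replicate i 0 ++ List.replicate b 1 ++ List.replicate c 2) [2]
    (List.replicate e 1 ++ List.replicate f 2)
    (by simp [Nat.add_assoc]) (by simp; omega) (by simp [List.filter_append, List.replicate_add])
  simpa [wordClass] using this

theorem yx_dvd_mm {i j l t : ℕ} (h : i + j + l = d) (hi : 1 ≤ i) (hj : 1 ≤ j)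
    (ht : t + 1 < i + j) :
    letterClass k d t 1 * letterClass k d (t + 1) 0 ∣ mm k d i j := by
  obtain ⟨a, b, rfl, ha, hb⟩ : ∃ a b, t = a + b ∧ a + 1 ≤ i ∧ b + 1 ≤ j := by
    by_cases hti : t < i
    · exact ⟨t, 0, by omega⟩
    · exact ⟨i - 1, t - (i - 1), by omega⟩
  obtain ⟨e, rfl⟩ := Nat.exists_eq_add_of_le ha
  obtain ⟨f, rfl⟩ := Nat.exists_eq_add_of_le hb
  have := wordClass_dvd_mm (k := k) (t := a + b) h
    (List.replicate a 0 ++ List.replicate b 1) [1, 0]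
    (List.replicate e 0 ++ List.replicate f 1 ++ List.replicate l 2)
    (by simp) (by simp; omega) (by simp [List.filter_append, List.replicate_add])
  simpa [wordClass] using this

theorem zy_dvd_mm {i j l t : ℕ} (h : i + j + l = d) (hj : 1 ≤ j) (hl : 1 ≤ l) (hi : i ≤ t)
    (ht : t + 1 < d) :
    letterClass k d t 2 * letterClass k d (t + 1) 1 ∣ mm k d i j := by
  obtain ⟨b, c, rfl, hb, hc⟩ : ∃ b c, t = i + b + c ∧ b + 1 ≤ j ∧ c + 1 ≤ l := by
    by_cases htj : t < i + j
    · exact ⟨t - i - (t + 1 - (i + j)), t + 1 - (i + j), by omega⟩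
    · exact ⟨j - 1, t - i - (j - 1), by omega⟩
  obtain ⟨e, rfl⟩ := Nat.exists_eq_add_of_le hb
  obtain ⟨f, rfl⟩ := Nat.exists_eq_add_of_le hc
  have := wordClass_dvd_mm (k := k) (t := i + b + c) h
    (List.replicate i 0 ++ List.replicate b 1 ++ List.replicate c 2) [2, 1]
    (List.replicate e 1 ++ List.replicate f 2)
    (by simp [Nat.add_assoc]) (by simp; omega) (by simp [List.filter_append, List.replicate_add])
  simpa [wordClass] using this

theorem xz_dvd_mm {i j l : ℕ} (h : i + 1 + j + (1 + l) = d) :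
    letterClass k d i 0 * letterClass k d (i + 1) 2 ∣ mm k d (i + 1) j := by
  have := wordClass_dvd_mm (k := k) (t := i) h (List.replicate i 0) [0, 2]
    (List.replicate l 2 ++ List.replicate j 1)
    (by simp) (by simp; omega)
    (by simp [List.filter_append, List.replicate_add])
  simpa [wordClass] using this

theorem yy_dvd_mm {t : ℕ} (ht : t + 1 < d) :
    letterClass k d t 1 * letterClass k d (t + 1) 1 ∣ mm k d 0 d := by
  have := wordClass_dvd_mm (k := k) (d := d) (t := t) (i := 0) (j := d) (l := 0) (by omega)
    (List.replicate t 1) [1, 1] (List.replicate (d - t - 2) 1)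
    (by simp) (by simp; omega) (by simp [List.filter_append])
  simpa [wordClass] using this

theorem mul_eq_zero_of_dvd_of_dvd {R : Type*} [CommRing R] {u v a b : R} (hu : u ∣ a)
    (hv : v ∣ b) (h : u * v = 0) : a * b = 0 :=
  zero_dvd_iff.1 (h ▸ mul_dvd_mul hu hv)

theorem mm_mul_eq_zero_of_z_of_x {i j l i' j' l' t : ℕ} (h : i + j + l = d)
    (h' : i' + j' + l' = d) (hl : 1 ≤ l) (hi : i ≤ t) (hi' : 1 ≤ i') (ht : t + 1 < i' + j') :
    mm k d i j * mm k d i' j' = 0 :=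
  mul_eq_zero_of_dvd_of_dvd (z_dvd_mm h hl hi (by omega)) (x_dvd_mm h' hi' ht)
    (letterClass_z_mul_x (by omega))

theorem mm_y_mul_eq_zero {i j l : ℕ} (h : i + j + l = d) (hi : 1 ≤ i) (hl : 1 ≤ l) :
    mm k d 0 d * mm k d i j = 0 := by
  obtain ⟨i, rfl⟩ := Nat.exists_eq_add_of_le' hi
  obtain ⟨l, rfl⟩ := Nat.exists_eq_add_of_le hl
  exact mul_eq_zero_of_dvd_of_dvd (yy_dvd_mm (by omega)) (xz_dvd_mm h)
    (letterClass_yy_mul_xz (by omega))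

theorem mm_mul_eq_zero_of_z_of_yx {i j l i' j' l' t : ℕ} (h : i + j + l = d)
    (h' : i' + j' + l' = d) (hl : 1 ≤ l) (hi : i ≤ t + 1) (hi' : 1 ≤ i') (hj' : 1 ≤ j')
    (ht : t + 1 < i' + j') : mm k d i j * mm k d i' j' = 0 :=
  mul_eq_zero_of_dvd_of_dvd (z_dvd_mm h hl hi (by omega)) (yx_dvd_mm h' hi' hj' ht)
    (letterClass_z_mul_yx (by omega))

theorem mm_mul_eq_zero_of_x_of_zy {i j l i' j' l' t : ℕ} (h : i + j + l = d)
    (h' : i' + j' + l' = d) (hi : 1 ≤ i) (ht : t < i + j) (hj' : 1 ≤ j') (hl' : 1 ≤ l')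
    (hi' : i' ≤ t) (htd : t + 1 < d) : mm k d i j * mm k d i' j' = 0 :=
  mul_eq_zero_of_dvd_of_dvd (x_dvd_mm h hi ht) (zy_dvd_mm h' hj' hl' hi' htd)
    (letterClass_x_mul_zy (by omega))

/-- A class `m_{i,j,l}` with `i, j, l ≥ 1` annihilates every `m_{i',j',l'}`. -/
theorem mm_mul_eq_zero_of_pos {i j l i' j' l' : ℕ} (h : i + j + l = d) (h' : i' + j' + l' = d)
    (hi : 1 ≤ i) (hj : 1 ≤ j) (hl : 1 ≤ l) : mm k d i' j' * mm k d i j = 0 := by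
  rcases Nat.eq_zero_or_pos i' with rfl | hi'
  · rcases Nat.eq_zero_or_pos l' with rfl | hl'
    · obtain rfl : j' = d := by omega
      exact mm_y_mul_eq_zero h hi hl
    · exact mm_mul_eq_zero_of_z_of_x (t := 0) h' h hl' le_rfl hi (by omega)
  · rcases Nat.eq_zero_or_pos l' with rfl | hl'
    · rw [mul_comm]
      exact mm_mul_eq_zero_of_z_of_x (t := d - 2) h h' hl (by omega) hi' (by omega)
    · rcases Nat.lt_or_ge i i' with hlt | hle
      · exact mm_mul_eq_zero_of_x_of_zy (t := i' - 1) h' h hi' (by omega) hj hl (by omega)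
          (by omega)
      · exact mm_mul_eq_zero_of_z_of_yx (t := i' - 1) h' h hl' (by omega) hi hj (by omega)

end

theorem statement_9 (k : Type) [Field k] (d : ℕ) (hd : 2 ≤ d) :
    -- (1)
    (∀ i j l i' j' l' : ℕ, i + j + l = d → i' + j' + l' = d →
      1 ≤ i → 1 ≤ j → 1 ≤ l → mm k d i' j' * mm k d i j = 0) ∧
    -- (2)
    (∀ i : ℕ, i < d → mm k d d 0 * mm k d 0 i = 0) ∧
    (∀ i : ℕ, i ≤ d - 2 → mm k d d 0 * mm k d i 0 = 0) ∧
    -- (3)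
    (∀ i : ℕ, 1 ≤ i → i ≤ d - 1 → mm k d 0 d * mm k d i 0 = 0) ∧
    -- (4)
    (∀ i : ℕ, 1 ≤ i → i ≤ d - 1 → mm k d 0 0 * mm k d i (d - i) = 0) ∧
    (∀ i : ℕ, 2 ≤ i → i ≤ d → mm k d 0 0 * mm k d i 0 = 0) ∧
    -- (5)
    (∀ i : ℕ, 1 ≤ i → i ≤ d - 1 →
      (∀ j : ℕ, j < d → mm k d i 0 * mm k d j (d - j) = 0) ∧
      (∀ j : ℕ, 1 ≤ j → j ≤ d → mm k d i 0 * mm k d 0 j = 0) ∧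
      (∀ j : ℕ, j ≤ d → j ≠ i - 1 → j ≠ i → j ≠ i + 1 → mm k d i 0 * mm k d j 0 = 0)) ∧
    -- (6)
    (∀ i j : ℕ, 1 ≤ i → i ≤ d → j < d → mm k d i (d - i) * mm k d 0 j = 0) := by
  refine ⟨fun i j l i' j' l' h h' hi hj hl => mm_mul_eq_zero_of_pos h h' hi hj hl,
    fun i hi => ?_, fun i hi => ?_, fun i h1 h2 => ?_, fun i h1 h2 => ?_, fun i h1 h2 => ?_,
    fun i h1 h2 => ⟨fun j hj => ?_, fun j hj hjd => ?_, fun j hj n1 n2 n3 => ?_⟩,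
    fun i j h1 h2 hj => ?_⟩
  · rw [mul_comm]
    exact mm_mul_eq_zero_of_z_of_x (t := 0) (l := d - i) (l' := 0) (by omega) (by omega)
      (by omega) (by omega) (by omega) (by omega)
  · rw [mul_comm]
    exact mm_mul_eq_zero_of_z_of_x (t := i) (l := d - i) (l' := 0) (by omega) (by omega)
      (by omega) (by omega) (by omega) (by omega)
  · exact mm_y_mul_eq_zero (l := d - i) (by omega) h1 (by omega)
  · exact mm_mul_eq_zero_of_z_of_x (t := 0) (l := d) (l' := 0) (by omega) (by omega)
      (by omega) (by omega) (by omega) (by omega)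
  · exact mm_mul_eq_zero_of_z_of_x (t := 0) (l := d) (l' := d - i) (by omega) (by omega)
      (by omega) (by omega) (by omega) (by omega)
  · rcases Nat.eq_zero_or_pos j with rfl | hj0
    · rw [mul_comm]
      exact mm_y_mul_eq_zero (l := d - i) (by omega) h1 (by omega)
    · exact mm_mul_eq_zero_of_z_of_yx (t := i - 1) (l := d - i) (l' := 0) (by omega) (by omega)
        (by omega) (by omega) (by omega) (by omega) (by omega)
  · rcases hjd.eq_or_lt with rfl | hlt
    · rw [mul_comm]
      exact mm_y_mul_eq_zero (l := j - i) (by omega) h1 (by omega)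
    · exact mm_mul_eq_zero_of_x_of_zy (t := i - 1) (l := d - i) (l' := d - j) (by omega)
        (by omega) (by omega) (by omega) (by omega) (by omega) (by omega) (by omega)
  · rcases Nat.lt_or_ge i j with hlt | hle
    · exact mm_mul_eq_zero_of_z_of_x (t := i) (l := d - i) (l' := d - j) (by omega) (by omega)
        (by omega) (by omega) (by omega) (by omega)
    · rw [mul_comm]
      exact mm_mul_eq_zero_of_z_of_x (t := j) (l := d - j) (l' := d - i) (by omega) (by omega)
        (by omega) (by omega) (by omega) (by omega)
  · rw [mul_comm]
    exact mm_mul_eq_zero_of_z_of_x (t := 0) (l := d - j) (l' := 0) (by omega) (by omega)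
      (by omega) (by omega) (by omega) (by omega)
end

section
/- Let k be an algebraically closed field and d ≥ 2. A d-tuple (p_0, …, p_{d−1}) of points of ℙ^2(k), with homogeneous coordinates p_i = [x_i : y_i : z_i], satisfies the equations x_i y_{i+1} − y_i x_{i+1} = 0, y_i z_{i+1} − z_i y_{i+1} = 0, and z_i x_{i+1} = 0 for all 0 ≤ i ≤ d−2 if and only if the tuple has one of the following forms: (a) p_0 = p_1 = ⋯ = p_{d−1} = [x : y : 0] for some [x : y] ∈ ℙ^1(k); (b) p_0 = ⋯ = p_{d−1} = [0 : y : z] for some [y : z] ∈ ℙ^1(k); (c) p_0 = ⋯ = p_{i−1} = [1:0:0], p_i = [x : 0 : z] for some [x : z] ∈ ℙ^1(k), and p_{i+1} = ⋯ = p_{d−1} = [0:0:1], for some 0 ≤ i ≤ d−1. -/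
/-!
Statement 10: Description of the `d`-tuples of points of `ℙ²(k)` satisfying the
multilinearized relations of `A = k⟨x,y,z⟩/⟨xy−yx, yz−zy, zx⟩`, i.e. the closed
points of the truncated point scheme `Υ_d(A) ⊆ (ℙ²)^{×d}`.

A point of `ℙ²(k)` is represented by a nonzero vector `v : Fin 3 → k` (its
homogeneous coordinates `[v 0 : v 1 : v 2]`); two vectors represent the same
point iff they are nonzero scalar multiples of each other.  The vanishing of the
bihomogeneous equations is independent of the choice of representatives, so we
state the result for an arbitrary choice of representatives `v i` of the points
`p_i`.
-/

/-- `propEq v w` : the nonzero vectors `v` and `w` represent the same point of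
`ℙ²(k)`, i.e. they are proportional by a nonzero scalar. -/
def propEq {k : Type} [Field k] (v w : Fin 3 → k) : Prop :=
  ∃ c : k, c ≠ 0 ∧ v = c • w

theorem propEq_of_mul_eq {k : Type} [Field k] {v w : Fin 3 → k} {j : Fin 3} (hv : v j ≠ 0)
    (hw : w j ≠ 0) (h : ∀ i, v i * w j = w i * v j) : propEq v w :=
  ⟨v j / w j, div_ne_zero hv hw, by
    ext i
    simp only [Pi.smul_apply, smul_eq_mul]
    field_simp
    linear_combination h i⟩

theorem exists_ne_zero_of_ne_zero {k : Type} [Field k] {v : Fin 3 → k} (hv : v ≠ 0) :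
    ¬(v 0 = 0 ∧ v 1 = 0 ∧ v 2 = 0) := by
  rintro ⟨h0, h1, h2⟩
  exact hv (by ext i; fin_cases i <;> simp [h0, h1, h2])

/-- A solution sequence of the relations whose first middle coordinate is nonzero is constant
in the projective plane. -/
theorem propEq_zero_of_relations {k : Type} [Field k] {d : ℕ} (hd : 0 < d)
    {v : Fin d → Fin 3 → k} (hv : ∀ i, v i ≠ 0)
    (hxy : ∀ (i : ℕ) (h : i + 1 < d),
      v ⟨i, Nat.lt_of_succ_lt h⟩ 0 * v ⟨i + 1, h⟩ 1 -
        v ⟨i, Nat.lt_of_succ_lt h⟩ 1 * v ⟨i + 1, h⟩ 0 = 0)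
    (hyz : ∀ (i : ℕ) (h : i + 1 < d),
      v ⟨i, Nat.lt_of_succ_lt h⟩ 1 * v ⟨i + 1, h⟩ 2 -
        v ⟨i, Nat.lt_of_succ_lt h⟩ 2 * v ⟨i + 1, h⟩ 1 = 0)
    (h0 : v ⟨0, hd⟩ 1 ≠ 0) (i : Fin d) : propEq (v i) (v ⟨0, hd⟩) := by
  obtain ⟨i, hi⟩ := i
  induction i with
  | zero => exact ⟨1, one_ne_zero, by simp⟩
  | succ n ih =>
    obtain ⟨c, hc, h⟩ := ih (by omega)
    have e1 := hxy n hi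
    have e2 := hyz n hi
    simp only [h, Pi.smul_apply, smul_eq_mul] at e1 e2
    have e1' : v ⟨n + 1, hi⟩ 0 * v ⟨0, hd⟩ 1 = v ⟨0, hd⟩ 0 * v ⟨n + 1, hi⟩ 1 :=
      mul_left_cancel₀ hc (by linear_combination -e1)
    have e2' : v ⟨n + 1, hi⟩ 2 * v ⟨0, hd⟩ 1 = v ⟨0, hd⟩ 2 * v ⟨n + 1, hi⟩ 1 :=
      mul_left_cancel₀ hc (by linear_combination e2)
    have hne : v ⟨n + 1, hi⟩ 1 ≠ 0 := by
      intro hz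
      simp only [hz, mul_zero, mul_eq_zero, h0, or_false] at e1' e2'
      exact exists_ne_zero_of_ne_zero (hv _) ⟨e1', hz, e2'⟩
    refine propEq_of_mul_eq (j := 1) hne h0 fun j => ?_
    fin_cases j
    · exact e1'
    · exact mul_comm _ _
    · exact e2'

/-- A solution sequence of the relations whose first middle coordinate vanishes has all middle
coordinates zero. -/
theorem middle_eq_zero_of_relations {k : Type} [Field k] {d : ℕ} (hd : 0 < d)
    {v : Fin d → Fin 3 → k} (hv : ∀ i, v i ≠ 0)
    (hxy : ∀ (i : ℕ) (h : i + 1 < d),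
      v ⟨i, Nat.lt_of_succ_lt h⟩ 0 * v ⟨i + 1, h⟩ 1 -
        v ⟨i, Nat.lt_of_succ_lt h⟩ 1 * v ⟨i + 1, h⟩ 0 = 0)
    (hyz : ∀ (i : ℕ) (h : i + 1 < d),
      v ⟨i, Nat.lt_of_succ_lt h⟩ 1 * v ⟨i + 1, h⟩ 2 -
        v ⟨i, Nat.lt_of_succ_lt h⟩ 2 * v ⟨i + 1, h⟩ 1 = 0)
    (h0 : v ⟨0, hd⟩ 1 = 0) (i : Fin d) : v i 1 = 0 := by
  obtain ⟨i, hi⟩ := i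
  induction i with
  | zero => exact h0
  | succ n ih =>
    have h := ih (by omega)
    by_contra hz
    have e1 := hxy n hi
    have e2 := hyz n hi
    simp only [h, zero_mul, sub_zero, zero_sub, neg_eq_zero, mul_eq_zero, hz, or_false] at e1 e2
    exact exists_ne_zero_of_ne_zero (hv _) ⟨e1, h, e2⟩

/-- In a sequence of points on the line `y = 0` satisfying `z x' = 0`, every point after one
off `[1 : 0 : 0]` is `[0 : 0 : 1]`. -/
theorem first_eq_zero_of_lt {k : Type} [Field k] {d : ℕ}
    {v : Fin d → Fin 3 → k} (hv : ∀ i, v i ≠ 0) (hy : ∀ i, v i 1 = 0)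
    (hzx : ∀ (i : ℕ) (h : i + 1 < d), v ⟨i, Nat.lt_of_succ_lt h⟩ 2 * v ⟨i + 1, h⟩ 0 = 0)
    {m : ℕ} (hm : m < d) (h2 : v ⟨m, hm⟩ 2 ≠ 0) (j : ℕ) (hj : j < d) (hmj : m + 1 ≤ j) :
    v ⟨j, hj⟩ 0 = 0 := by
  induction j, hmj using Nat.le_induction with
  | base => exact (mul_eq_zero.1 (hzx m hj)).resolve_left h2
  | succ n hn ih =>
    exact (mul_eq_zero.1 (hzx n hj)).resolve_left fun h =>
      exists_ne_zero_of_ne_zero (hv _) ⟨ih (by omega), hy _, h⟩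

theorem propEq_of_last_two_eq_zero {k : Type} [Field k] {v : Fin 3 → k} (hv : v ≠ 0)
    (h1 : v 1 = 0) (h2 : v 2 = 0) : propEq v ![1, 0, 0] :=
  ⟨v 0, fun h => exists_ne_zero_of_ne_zero hv ⟨h, h1, h2⟩, by
    ext i; fin_cases i <;> simp [h1, h2]⟩

theorem propEq_of_first_two_eq_zero {k : Type} [Field k] {v : Fin 3 → k} (hv : v ≠ 0)
    (h0 : v 0 = 0) (h1 : v 1 = 0) : propEq v ![0, 0, 1] :=
  ⟨v 2, fun h => exists_ne_zero_of_ne_zero hv ⟨h0, h1, h⟩, by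
    ext i; fin_cases i <;> simp [h0, h1]⟩

theorem vec_eq_of_middle_eq_zero {k : Type} [Field k] {v : Fin 3 → k} (h1 : v 1 = 0) :
    v = ![v 0, 0, v 2] := by
  ext i; fin_cases i <;> simp [h1]

theorem statement_10 (k : Type) [Field k] [IsAlgClosed k] (d : ℕ) (hd : 2 ≤ d)
    (v : Fin d → Fin 3 → k) (hv : ∀ i, v i ≠ 0) :
    -- the multilinearized defining relations of `A`
    ((∀ (i : ℕ) (h : i + 1 < d),
        v ⟨i, by omega⟩ 0 * v ⟨i + 1, h⟩ 1 - v ⟨i, by omega⟩ 1 * v ⟨i + 1, h⟩ 0 = 0 ∧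
        v ⟨i, by omega⟩ 1 * v ⟨i + 1, h⟩ 2 - v ⟨i, by omega⟩ 2 * v ⟨i + 1, h⟩ 1 = 0 ∧
        v ⟨i, by omega⟩ 2 * v ⟨i + 1, h⟩ 0 = 0)
      ↔
      -- (a)  all points equal to `[x : y : 0]`
      ((∃ x y : k, ¬(x = 0 ∧ y = 0) ∧ ∀ i : Fin d, propEq (v i) ![x, y, 0]) ∨
      -- (b)  all points equal to `[0 : y : z]`
      (∃ y z : k, ¬(y = 0 ∧ z = 0) ∧ ∀ i : Fin d, propEq (v i) ![0, y, z]) ∨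
      -- (c)  `e₁, …, e₁, [x : 0 : z], e₃, …, e₃` with `[x : 0 : z]` in position `i₀`
      (∃ (i₀ : ℕ) (_ : i₀ < d) (x z : k), ¬(x = 0 ∧ z = 0) ∧
        (∀ j : Fin d, (j : ℕ) < i₀ → propEq (v j) ![1, 0, 0]) ∧
        propEq (v ⟨i₀, by omega⟩) ![x, 0, z] ∧
        (∀ j : Fin d, i₀ < (j : ℕ) → propEq (v j) ![0, 0, 1])))) := by
  have hd0 : 0 < d := by omega
  have propEq_self : ∀ w : Fin 3 → k, propEq w w := fun w => ⟨1, one_ne_zero, by simp⟩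
  constructor
  · intro h
    have hxy := fun i hi => (h i hi).1
    have hyz := fun i hi => (h i hi).2.1
    have hzx := fun i hi => (h i hi).2.2
    by_cases h0 : v ⟨0, hd0⟩ 1 = 0
    · have hy := middle_eq_zero_of_relations hd0 hv hxy hyz h0
      have key : ∀ (m : ℕ) (hm : m < d), (∀ j : Fin d, (j : ℕ) < m → v j 2 = 0) →
          (∀ j : Fin d, m < (j : ℕ) → v j 0 = 0) →
          ∃ (i₀ : ℕ) (_ : i₀ < d) (x z : k), ¬(x = 0 ∧ z = 0) ∧
            (∀ j : Fin d, (j : ℕ) < i₀ → propEq (v j) ![1, 0, 0]) ∧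
            propEq (v ⟨i₀, by omega⟩) ![x, 0, z] ∧
            (∀ j : Fin d, i₀ < (j : ℕ) → propEq (v j) ![0, 0, 1]) := by
        intro m hm hlt hgt
        refine ⟨m, hm, v ⟨m, hm⟩ 0, v ⟨m, hm⟩ 2,
          fun ⟨hx, hz⟩ => exists_ne_zero_of_ne_zero (hv _) ⟨hx, hy _, hz⟩,
          fun j hj => propEq_of_last_two_eq_zero (hv j) (hy j) (hlt j hj), ?_,
          fun j hj => propEq_of_first_two_eq_zero (hv j) (hgt j hj) (hy j)⟩
        rw [← vec_eq_of_middle_eq_zero (hy ⟨m, hm⟩)]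
        exact propEq_self _
      right; right
      by_cases hex : ∃ m, ∃ hm : m < d, v ⟨m, hm⟩ 2 ≠ 0
      · classical
        obtain ⟨hm, hne⟩ := Nat.find_spec hex
        refine key (Nat.find hex) hm (fun j hj => ?_)
          fun j hj => first_eq_zero_of_lt hv hy hzx hm hne j j.2 hj
        by_contra hne'
        exact Nat.find_min hex hj ⟨j.2, hne'⟩
      · push Not at hex
        exact key (d - 1) (by omega) (fun j _ => hex j j.2) fun j hj => by omega
    · have hp := propEq_zero_of_relations hd0 hv hxy hyz h0
      obtain ⟨c, hc, h1⟩ := hp ⟨1, by omega⟩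
      have e := hzx 0 (by omega)
      simp only [zero_add, h1, Pi.smul_apply, smul_eq_mul, mul_eq_zero, hc, false_or] at e
      rcases e with e | e
      · refine Or.inl ⟨v ⟨0, hd0⟩ 0, v ⟨0, hd0⟩ 1, fun hh => h0 hh.2, fun i => ?_⟩
        convert hp i using 1
        ext j; fin_cases j <;> simp [e]
      · refine Or.inr (Or.inl ⟨v ⟨0, hd0⟩ 1, v ⟨0, hd0⟩ 2, fun hh => h0 hh.1,
          fun i => ?_⟩)
        convert hp i using 1
        ext j; fin_cases j <;> simp [e]
  · rintro (⟨x, y, -, h⟩ | ⟨y, z, -, h⟩ | ⟨m, hm, x, z, -, hlt, he, hgt⟩) i hi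
    · obtain ⟨a, -, ha⟩ := h ⟨i, by omega⟩
      obtain ⟨b, -, hb⟩ := h ⟨i + 1, hi⟩
      simp [ha, hb]
      ring
    · obtain ⟨a, -, ha⟩ := h ⟨i, by omega⟩
      obtain ⟨b, -, hb⟩ := h ⟨i + 1, hi⟩
      simp [ha, hb]
      ring
    · have hy : ∀ j : Fin d, v j 1 = 0 := by
        intro j
        rcases lt_trichotomy (j : ℕ) m with hj | hj | hj
        · obtain ⟨a, -, ha⟩ := hlt j hj
          simp [ha]
        · obtain ⟨a, -, ha⟩ := he
          obtain rfl : j = ⟨m, hm⟩ := Fin.ext hj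
          simp [ha]
        · obtain ⟨a, -, ha⟩ := hgt j hj
          simp [ha]
      refine ⟨by simp [hy], by simp [hy], ?_⟩
      rcases lt_or_ge i m with hj | hj
      · obtain ⟨a, -, ha⟩ := hlt ⟨i, by omega⟩ hj
        simp [ha]
      · obtain ⟨a, -, ha⟩ := hgt ⟨i + 1, hi⟩ (Nat.lt_succ_of_le hj)
        simp [ha]
end

section
/- Let k be a field, d ≥ 2, S(d) = k[x_i, y_i, z_i : 0 ≤ i ≤ d−1], K the ideal generated by x_i y_{i+1} − y_i x_{i+1}, y_i z_{i+1} − z_i y_{i+1}, z_i x_{i+1} (0 ≤ i ≤ d−2), and let U be the k-subalgebra of S(d)/K generated by the elements m_{i,j,l} (classes of x_0⋯x_{i−1} y_i⋯y_{i+j−1} z_{i+j}⋯z_{d−1}, i+j+l = d), graded so that each m_{i,j,l} has degree 1. Then for each of the elements w ∈ {m_{i,0,d−i} : 0 ≤ i ≤ d} ∪ {m_{0,d,0}}, the degree-zero part of the localization of U at w is isomorphic as a k-algebra to k[s,t]/(st). In particular, each such localization is reduced and its ring of degree-zero fractions has exactly one singular point, a nodal singularity. -/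
/-!
Statement 11: For `A = k⟨x,y,z⟩/⟨xy−yx, yz−zy, zx⟩`, let `U` be the subalgebra
of `S(d)/K` generated by the elements `m_{i,j,l}` (the model of `U_d(A)`), graded
with each `m_{i,j,l}` in degree 1.  For each
`w ∈ {m_{i,0,d−i} : 0 ≤ i ≤ d} ∪ {m_{0,d,0}}`, the degree-zero part of the
localization `U_(w)` — which, since `U` is generated in degree `1` by the
`m_{i,j,l}` and `w` has degree `1`, is the `k`-subalgebra of the localization
`U_w` generated by the fractions `m_{i,j,l}/w` — is isomorphic as a `k`-algebra
to `k[s,t]/(st)`.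
-/

open MvPolynomial

noncomputable section

variable (k : Type) [Field k] (d : ℕ)

/-- `k[s,t]/(st)`. -/
def NodalRing := MvPolynomial (Fin 2) k ⧸
  (Ideal.span {(X 0 * X 1 : MvPolynomial (Fin 2) k)})

instance : CommRing (NodalRing k) := by unfold NodalRing; infer_instance
instance : Algebra k (NodalRing k) := by unfold NodalRing; infer_instance

/-- The degree-zero part of the localization of `U` at the degree-one element `w`:
the `k`-subalgebra of `Localization.Away w` generated by the fractions
`m_{i,j,l} / w` for `i + j + l = d`. -/
def degZeroLoc (w : Sd k d ⧸ KK k d) : Subalgebra k (Localization.Away w) :=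
  Algebra.adjoin k {q | ∃ i j l : ℕ, i + j + l = d ∧
    q = algebraMap _ _ (mm k d i j) * Localization.Away.invSelf w}

end


open MvPolynomial in
theorem nodalRing_presentation (k : Type) [Field k] :
    ∃ s t : NodalRing k, s * t = 0 ∧ Algebra.adjoin k {s, t} = ⊤ ∧
      ∀ (L : Type) [CommRing L] [Algebra k L] (a b : L), a * b = 0 →
        ∃ Θ : NodalRing k →ₐ[k] L, Θ s = a ∧ Θ t = b := by
  let I : Ideal (MvPolynomial (Fin 2) k) := Ideal.span {X 0 * X 1}
  let π : MvPolynomial (Fin 2) k →ₐ[k] NodalRing k := Ideal.Quotient.mkₐ k I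
  have hπ : Function.Surjective π := Ideal.Quotient.mkₐ_surjective k I
  refine ⟨π (X 0), π (X 1), ?_, ?_, ?_⟩
  · rw [← map_mul]
    exact Ideal.Quotient.eq_zero_iff_mem.2 (Ideal.subset_span rfl)
  · have hrange : (Set.range (X : Fin 2 → MvPolynomial (Fin 2) k)) = {X 0, X 1} := by
      ext p
      simp [Fin.exists_fin_two, eq_comm]
    have h := congrArg (Subalgebra.map π) (MvPolynomial.adjoin_range_X (R := k) (σ := Fin 2))
    rw [AlgHom.map_adjoin, hrange, Set.image_pair, Algebra.map_top,
      (AlgHom.range_eq_top π).2 hπ] at h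
    exact h
  · intro L _ _ a b hab
    let F : MvPolynomial (Fin 2) k →ₐ[k] L := aeval ![a, b]
    have hF : ∀ p ∈ I, F p = 0 := by
      intro p hp
      have : I ≤ RingHom.ker F := by
        refine Ideal.span_le.2 ?_
        rintro _ rfl
        simp [F, RingHom.mem_ker, hab]
      exact this hp
    let Θ : NodalRing k →ₐ[k] L := Ideal.Quotient.liftₐ I F hF
    have hΘ : ∀ p, Θ (π p) = F p := fun p => Ideal.Quotient.lift_mk I _ hF
    exact ⟨Θ, by simp [hΘ, F], by simp [hΘ, F]⟩

/-- The relations generating `KK`, imposed on a family of elements of a ring. -/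
def SatisfiesRel {d : ℕ} {R : Type} [CommRing R] (f : Fin d × Fin 3 → R) : Prop :=
  ∀ (i : ℕ) (h : i + 1 < d),
    f (⟨i, by omega⟩, 0) * f (⟨i + 1, h⟩, 1) = f (⟨i, by omega⟩, 1) * f (⟨i + 1, h⟩, 0) ∧
    f (⟨i, by omega⟩, 1) * f (⟨i + 1, h⟩, 2) = f (⟨i, by omega⟩, 2) * f (⟨i + 1, h⟩, 1) ∧
    f (⟨i, by omega⟩, 2) * f (⟨i + 1, h⟩, 0) = 0

/-- The letter (`0`, `1`, `2` for `x`, `y`, `z`) at position `t` of the monomial `mm k d i j`. -/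
def letter {d : ℕ} (i j : ℕ) (t : Fin d) : Fin 3 :=
  if (t : ℕ) < i then 0 else if (t : ℕ) < i + j then 1 else 2

theorem mm_eq_mk_prod (k : Type) [Field k] (d i j : ℕ) :
    mm k d i j =
      Ideal.Quotient.mk (KK k d) (∏ t : Fin d, MvPolynomial.X (t, letter i j t)) := by
  unfold mm
  congr 1
  refine Finset.prod_congr rfl fun t _ => ?_
  unfold letter xv yv zv
  split_ifs <;> rfl

theorem satisfiesRel_mk_X (k : Type) [Field k] (d : ℕ) :
    SatisfiesRel fun v : Fin d × Fin 3 => Ideal.Quotient.mk (KK k d) (MvPolynomial.X v) := by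
  intro i h
  simp only [← map_mul]
  refine ⟨Ideal.Quotient.eq.2 (Ideal.subset_span ⟨i, h, .inl rfl⟩),
    Ideal.Quotient.eq.2 (Ideal.subset_span ⟨i, h, .inr (.inl rfl)⟩),
    Ideal.Quotient.eq_zero_iff_mem.2 (Ideal.subset_span ⟨i, h, .inr (.inr rfl)⟩)⟩

theorem SatisfiesRel.map {d : ℕ} {R S : Type} [CommRing R] [CommRing S]
    {f : Fin d × Fin 3 → R} (hf : SatisfiesRel f) (φ : R →+* S) :
    SatisfiesRel fun v => φ (f v) := by
  intro i h
  obtain ⟨h1, h2, h3⟩ := hf i h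
  simp only [← map_mul, h1, h2, h3, map_zero, and_self]

theorem SatisfiesRel.mul {d : ℕ} {R : Type} [CommRing R]
    {f : Fin d × Fin 3 → R} (hf : SatisfiesRel f) (u : Fin d → R) :
    SatisfiesRel fun v => f v * u v.1 := by
  intro i h
  obtain ⟨h1, h2, h3⟩ := hf i h
  refine ⟨?_, ?_, ?_⟩
  · linear_combination u ⟨i, by omega⟩ * u ⟨i + 1, h⟩ * h1
  · linear_combination u ⟨i, by omega⟩ * u ⟨i + 1, h⟩ * h2
  · linear_combination u ⟨i, by omega⟩ * u ⟨i + 1, h⟩ * h3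

theorem SatisfiesRel.exists_algHom {k : Type} [Field k] {d : ℕ} {R : Type} [CommRing R]
    [Algebra k R] {g : Fin d × Fin 3 → R} (hg : SatisfiesRel g) :
    ∃ ψ : (Sd k d ⧸ KK k d) →ₐ[k] R,
      ∀ v, ψ (Ideal.Quotient.mk (KK k d) (MvPolynomial.X v)) = g v := by
  have hker : KK k d ≤ RingHom.ker (MvPolynomial.aeval (R := k) g) := by
    refine Ideal.span_le.2 ?_
    rintro _ ⟨i, h, rfl | rfl | rfl⟩ <;> obtain ⟨h1, h2, h3⟩ := hg i h <;>
      simp [RingHom.mem_ker, xv, yv, zv, h1, h2, h3]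
  exact ⟨Ideal.Quotient.liftₐ (KK k d) (MvPolynomial.aeval g) fun p hp => hker hp,
    fun v => (Ideal.Quotient.lift_mk _ _ _).trans (MvPolynomial.aeval_X _ _)⟩

/-- If the generic point of the chart where `mm k d i₀ j₀` is invertible is obtained, after
normalization, from a point `g` with values in the nodal ring, and the two coordinates
of the nodal ring are themselves values of monomials at `g`, then the chart is nodal. -/
theorem nonempty_degZeroLoc_algEquiv (k : Type) [Field k] (d i₀ j₀ : ℕ) {s t : NodalRing k}
    (hst : Algebra.adjoin k {s, t} = ⊤)
    (g : Fin d × Fin 3 → NodalRing k) (hg : SatisfiesRel g)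
    (hg₀ : ∀ a, g (a, letter i₀ j₀ a) = 1)
    (hs : ∃ i j, i + j ≤ d ∧ ∏ a, g (a, letter i j a) = s)
    (ht : ∃ i j, i + j ≤ d ∧ ∏ a, g (a, letter i j a) = t)
    (hfact : ∀ (L : Type) [CommRing L] [Algebra k L] (f : Fin d × Fin 3 → L),
      SatisfiesRel f → (∀ a, f (a, letter i₀ j₀ a) = 1) →
        ∃ Θ : NodalRing k →ₐ[k] L, ∀ v, Θ (g v) = f v) :
    Nonempty (degZeroLoc k d (mm k d i₀ j₀) ≃ₐ[k] NodalRing k) := by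
  set w := mm k d i₀ j₀ with hw
  let L := Localization.Away w
  let φ : (Sd k d ⧸ KK k d) →+* L := algebraMap _ _
  let f₀ : Fin d × Fin 3 → L := fun v => φ (Ideal.Quotient.mk (KK k d) (MvPolynomial.X v))
  have hmm : ∀ i j, φ (mm k d i j) = ∏ a, f₀ (a, letter i j a) := by
    intro i j
    rw [mm_eq_mk_prod, map_prod, map_prod]
  have hinv : φ w * Localization.Away.invSelf w = 1 := by
    rw [Localization.Away.invSelf, Localization.mk_eq_mk', mul_comm]
    exact (IsLocalization.mk'_spec L 1
      (⟨w, Submonoid.mem_powers w⟩ : Submonoid.powers w)).trans (map_one _)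
  have hunit : ∀ a, ∃ b, f₀ (a, letter i₀ j₀ a) * b = 1 := by
    intro a
    have h : IsUnit (∏ a, f₀ (a, letter i₀ j₀ a)) := by
      rw [← hmm]
      exact IsUnit.of_mul_eq_one _ hinv
    exact (isUnit_of_dvd_unit (Finset.dvd_prod_of_mem _ (Finset.mem_univ a)) h).exists_right_inv
  choose u hu using hunit
  have hprod_u : Localization.Away.invSelf w = ∏ a, u a := by
    have h1 : φ w * ∏ a, u a = 1 := by
      rw [hmm i₀ j₀, ← Finset.prod_mul_distrib]
      exact Finset.prod_eq_one fun a _ => hu a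
    calc Localization.Away.invSelf w
        = (φ w * ∏ a, u a) * Localization.Away.invSelf w := by rw [h1, one_mul]
      _ = (φ w * Localization.Away.invSelf w) * ∏ a, u a := by ring
      _ = _ := by rw [hinv, one_mul]
  obtain ⟨Θ, hΘ⟩ := hfact L (fun v => f₀ v * u v.1)
    (((satisfiesRel_mk_X k d).map φ).mul u) hu
  have hΘmm : ∀ i j, Θ (∏ a, g (a, letter i j a)) =
      φ (mm k d i j) * Localization.Away.invSelf w := by
    intro i j
    rw [map_prod, hmm, hprod_u, ← Finset.prod_mul_distrib]
    exact Finset.prod_congr rfl fun a _ => hΘ _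
  obtain ⟨ψ₀, hψ₀⟩ := hg.exists_algHom (k := k)
  have hψ₀mm : ∀ i j, ψ₀ (mm k d i j) = ∏ a, g (a, letter i j a) := by
    intro i j
    rw [mm_eq_mk_prod, map_prod, map_prod]
    exact Finset.prod_congr rfl fun a _ => hψ₀ _
  have hψ₀w : ψ₀ w = 1 := by
    rw [hψ₀mm i₀ j₀]
    exact Finset.prod_eq_one fun a _ => hg₀ a
  let ψ : L →ₐ[k] NodalRing k :=
    IsLocalization.liftAlgHom (M := Submonoid.powers w) (f := ψ₀) <| by
    rintro ⟨_, n, rfl⟩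
    simp [hψ₀w]
  have hψφ : ∀ r, ψ (φ r) = ψ₀ r := fun r => IsLocalization.lift_eq _ r
  have hψinv : ψ (Localization.Away.invSelf w) = 1 := by
    have h := congrArg ψ hinv
    rwa [map_mul, hψφ, hψ₀w, one_mul, map_one] at h
  have hψΘ : ∀ i j, ψ (Θ (∏ a, g (a, letter i j a))) = ∏ a, g (a, letter i j a) := by
    intro i j
    rw [hΘmm, map_mul, hψinv, hψφ, hψ₀mm, mul_one]
  obtain ⟨is, js, hijs, rfl⟩ := hs
  obtain ⟨it, jt, hijt, rfl⟩ := ht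
  have hid : ψ.comp Θ = AlgHom.id k _ := by
    refine AlgHom.ext_of_adjoin_eq_top hst ?_
    rintro _ (rfl | rfl)
    · exact hψΘ is js
    · exact hψΘ it jt
  have hinj : Function.Injective Θ :=
    Function.LeftInverse.injective (g := ψ) fun x => DFunLike.congr_fun hid x
  have hrange : Θ.range = degZeroLoc k d w := by
    apply le_antisymm
    · rw [← Algebra.map_top, ← hst, AlgHom.map_adjoin]
      refine Algebra.adjoin_mono ?_
      rintro _ ⟨_, rfl | rfl, rfl⟩
      · exact ⟨is, js, d - (is + js), by omega, hΘmm is js⟩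
      · exact ⟨it, jt, d - (it + jt), by omega, hΘmm it jt⟩
    · refine Algebra.adjoin_le ?_
      rintro _ ⟨i, j, l, -, rfl⟩
      exact ⟨_, hΘmm i j⟩
  exact ⟨((AlgEquiv.ofInjective Θ hinj).trans (Subalgebra.equivOfEq _ _ hrange)).symm⟩

theorem Fin.apply_eq_apply_zero_of_succ {d : ℕ} {α : Type} {F : Fin d → α} (hd : 0 < d)
    (hF : ∀ (i : ℕ) (h : i + 1 < d), F ⟨i + 1, h⟩ = F ⟨i, by omega⟩) (a : Fin d) :
    F a = F ⟨0, hd⟩ := by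
  obtain ⟨n, hn⟩ := a
  induction n with
  | zero => rfl
  | succ n ih => rw [hF n hn, ih]

theorem SatisfiesRel.y_eq_zero {d i : ℕ} (hi : 0 < i) (hid : i < d) {L : Type}
    [CommRing L] {f : Fin d × Fin 3 → L} (hf : SatisfiesRel f)
    (hx : ∀ a : Fin d, (a : ℕ) < i → f (a, 0) = 1)
    (hz : ∀ a : Fin d, i ≤ (a : ℕ) → f (a, 2) = 1) (a : Fin d) : f (a, 1) = 0 := by
  obtain ⟨m, rfl⟩ : ∃ m, i = m + 1 := ⟨i - 1, by omega⟩
  obtain ⟨h1, h2, h3⟩ := hf m hid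
  rw [hx ⟨m, _⟩ (by simp), one_mul] at h1
  rw [hz ⟨m + 1, _⟩ (by simp), mul_one] at h2
  have hy' : f (⟨m + 1, hid⟩, 1) = 0 := by
    linear_combination h1 + f (⟨m + 1, hid⟩, 0) * h2 + f (⟨m + 1, hid⟩, 1) * h3
  have hy : f (⟨m, by omega⟩, 1) = 0 := by rw [h2, hy', mul_zero]
  have hup : ∀ n (h : m + 1 + n < d), f (⟨m + 1 + n, h⟩, 1) = 0 := by
    intro n
    induction n with
    | zero => exact fun _ => hy'
    | succ n ih =>
      intro h
      obtain ⟨-, h2, -⟩ := hf (m + 1 + n) h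
      rw [ih, hz ⟨m + 1 + n, _⟩ (by simp), zero_mul, one_mul] at h2
      exact h2.symm
  have hdown : ∀ n (h : n ≤ m), f (⟨n, by omega⟩, 1) = 0 := by
    intro n h
    induction h using Nat.decreasingInduction with
    | self => exact hy
    | of_succ n h ih =>
      obtain ⟨h1, -, -⟩ := hf n (by omega)
      rw [ih, hx ⟨n + 1, _⟩ (by simp; omega), mul_zero, mul_one] at h1
      exact h1.symm
  obtain ⟨n, hn⟩ := a
  rcases le_or_gt n m with h | h
  · exact hdown n h
  · obtain ⟨r, rfl⟩ := Nat.exists_eq_add_of_le (Nat.succ_le_of_lt h)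
    exact hup r hn

theorem nonempty_degZeroLoc_algEquiv_y (k : Type) [Field k] {d : ℕ} (hd : 2 ≤ d) :
    Nonempty (degZeroLoc k d (mm k d 0 d) ≃ₐ[k] NodalRing k) := by
  obtain ⟨s, t, hst, htop, hlift⟩ := nodalRing_presentation k
  refine nonempty_degZeroLoc_algEquiv k d 0 d htop (fun v => ![s, 1, t] v.2)
    ?_ ?_ ⟨1, d - 1, by omega, ?_⟩ ⟨0, d - 1, by omega, ?_⟩ ?_
  · intro i h
    simp [mul_comm t s, hst]
  · intro a
    simp [letter]
  · rw [Finset.prod_eq_single ⟨0, by omega⟩ _ (by simp)]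
    · simp [letter]
    · intro b _ hb
      rw [Ne, Fin.ext_iff] at hb
      simp [letter, hb, show (b : ℕ) < 1 + (d - 1) by grind]
  · rw [Finset.prod_eq_single ⟨d - 1, by omega⟩ _ (by simp)]
    · simp [letter]
    · intro b _ hb
      rw [Ne, Fin.ext_iff] at hb
      simp [letter, show (b : ℕ) < d - 1 by grind]
  · intro L _ _ f hf hf₁
    have hy : ∀ a, f (a, 1) = 1 := fun a => by simpa [letter] using hf₁ a
    have hx := Fin.apply_eq_apply_zero_of_succ (F := fun a => f (a, 0)) (by omega) fun i h => by
      simpa [hy] using (hf i h).1.symm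
    have hz := Fin.apply_eq_apply_zero_of_succ (F := fun a => f (a, 2)) (by omega) fun i h => by
      simpa [hy] using (hf i h).2.1
    obtain ⟨Θ, hs, ht⟩ := hlift L (f (⟨0, by omega⟩, 0)) (f (⟨0, by omega⟩, 2)) (by
      rw [mul_comm, ← hx ⟨1, by omega⟩]
      exact (hf 0 (by omega)).2.2)
    refine ⟨Θ, ?_⟩
    rintro ⟨a, e⟩
    fin_cases e
    · simpa [hs] using (hx a).symm
    · simp [hy]
    · simpa [ht] using (hz a).symm

theorem nonempty_degZeroLoc_algEquiv_z (k : Type) [Field k] {d : ℕ} (hd : 2 ≤ d) :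
    Nonempty (degZeroLoc k d (mm k d 0 0) ≃ₐ[k] NodalRing k) := by
  obtain ⟨s, t, hst, htop, hlift⟩ := nodalRing_presentation k
  refine nonempty_degZeroLoc_algEquiv k d 0 0 htop
    (fun v => ![if (v.1 : ℕ) = 0 then t else 0, s, 1] v.2)
    ?_ ?_ ⟨0, 1, by omega, ?_⟩ ⟨1, 0, by omega, ?_⟩ ?_
  · intro i h
    by_cases hi : i = 0 <;> simp [mul_comm t s, hst, hi]
  · intro a
    simp [letter]
  · rw [Finset.prod_eq_single ⟨0, by omega⟩ _ (by simp)]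
    · simp [letter]
    · intro b _ hb
      rw [Ne, Fin.ext_iff] at hb
      simp [letter, hb]
  · rw [Finset.prod_eq_single ⟨0, by omega⟩ _ (by simp)]
    · simp [letter]
    · intro b _ hb
      rw [Ne, Fin.ext_iff] at hb
      simp [letter, hb]
  · intro L _ _ f hf hf₁
    have hz : ∀ a, f (a, 2) = 1 := fun a => by simpa [letter] using hf₁ a
    have hx : ∀ i (h : i + 1 < d), f (⟨i + 1, h⟩, 0) = 0 := fun i h => by
      simpa [hz] using (hf i h).2.2
    have hy := Fin.apply_eq_apply_zero_of_succ (F := fun a => f (a, 1)) (by omega) fun i h => by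
      simpa [hz] using (hf i h).2.1.symm
    obtain ⟨Θ, hs, ht⟩ := hlift L (f (⟨0, by omega⟩, 1)) (f (⟨0, by omega⟩, 0)) (by
      have h := (hf 0 (by omega)).1
      rw [hx, mul_zero] at h
      rw [mul_comm, ← hy ⟨1, by omega⟩]
      exact h)
    refine ⟨Θ, ?_⟩
    rintro ⟨⟨n, hn⟩, e⟩
    fin_cases e
    · cases n with
      | zero => simp [ht]
      | succ n => simp [hx]
    · simpa [hs] using (hy ⟨n, hn⟩).symm
    · simp [hz]

theorem nonempty_degZeroLoc_algEquiv_x (k : Type) [Field k] {d : ℕ} (hd : 2 ≤ d) :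
    Nonempty (degZeroLoc k d (mm k d d 0) ≃ₐ[k] NodalRing k) := by
  obtain ⟨m, rfl⟩ : ∃ m, d = m + 2 := ⟨d - 2, by omega⟩
  obtain ⟨s, t, hst, htop, hlift⟩ := nodalRing_presentation k
  refine nonempty_degZeroLoc_algEquiv k (m + 2) (m + 2) 0 htop
    (fun v => ![1, s, if (v.1 : ℕ) = m + 1 then t else 0] v.2)
    ?_ ?_ ⟨m + 1, 1, by omega, ?_⟩ ⟨m + 1, 0, by omega, ?_⟩ ?_
  · intro i h
    have hi : i ≠ m + 1 := by omega
    by_cases hi' : i = m <;> simp [hst, hi, hi']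
  · intro a
    simp [letter]
  · rw [Finset.prod_eq_single ⟨m + 1, by omega⟩ _ (by simp)]
    · simp [letter]
    · intro b _ hb
      rw [Ne, Fin.ext_iff] at hb
      simp [letter, show (b : ℕ) < m + 1 by grind]
  · rw [Finset.prod_eq_single ⟨m + 1, by omega⟩ _ (by simp)]
    · simp [letter]
    · intro b _ hb
      rw [Ne, Fin.ext_iff] at hb
      simp [letter, show (b : ℕ) < m + 1 by grind]
  · intro L _ _ f hf hf₁
    have hx : ∀ a, f (a, 0) = 1 := fun a => by simpa [letter] using hf₁ a
    have hz : ∀ i (h : i + 1 < m + 2), f (⟨i, by omega⟩, 2) = 0 := fun i h => by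
      simpa [hx] using (hf i h).2.2
    have hy := Fin.apply_eq_apply_zero_of_succ (F := fun a => f (a, 1)) (by omega) fun i h => by
      simpa [hx] using (hf i h).1
    obtain ⟨Θ, hs, ht⟩ := hlift L (f (⟨0, by omega⟩, 1)) (f (⟨m + 1, by omega⟩, 2)) (by
      have h := (hf m (by omega)).2.1
      rw [hz m (by omega), zero_mul] at h
      rw [← hy ⟨m, by omega⟩]
      exact h)
    refine ⟨Θ, ?_⟩
    rintro ⟨⟨n, hn⟩, e⟩
    fin_cases e
    · simp [hx]
    · simpa [hs] using (hy ⟨n, hn⟩).symm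
    · by_cases h : n = m + 1
      · subst h
        simp [ht]
      · simp [h, hz n (by omega)]

theorem nonempty_degZeroLoc_algEquiv_xz (k : Type) [Field k] {d i : ℕ} (hi : 0 < i)
    (hid : i < d) : Nonempty (degZeroLoc k d (mm k d i 0) ≃ₐ[k] NodalRing k) := by
  obtain ⟨s, t, hst, htop, hlift⟩ := nodalRing_presentation k
  refine nonempty_degZeroLoc_algEquiv k d i 0 htop
    (fun v => ![if (v.1 : ℕ) < i then 1 else if (v.1 : ℕ) = i then t else 0, 0,
      if i ≤ (v.1 : ℕ) then 1 else if (v.1 : ℕ) + 1 = i then s else 0] v.2)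
    ?_ ?_ ⟨i - 1, 0, by omega, ?_⟩ ⟨i + 1, 0, by omega, ?_⟩ ?_
  · intro n h
    refine ⟨by simp, by simp, ?_⟩
    simp only [Matrix.cons_val]
    split_ifs <;> first | omega | simp
  · intro a
    by_cases h : (a : ℕ) < i
    · simp [letter, h]
    · simp [letter, h, not_lt.1 h]
  · rw [Finset.prod_eq_single ⟨i - 1, by omega⟩]
    · have h : ¬ i ≤ i - 1 := by omega
      have h' : i - 1 + 1 = i := by omega
      simp [letter, h, h']
    · intro b _ hb
      rw [Ne, Fin.ext_iff] at hb
      by_cases h : (b : ℕ) < i - 1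
      · have h' : (b : ℕ) < i := by omega
        simp [letter, h, h']
      · have h' : i ≤ (b : ℕ) := by simp at hb; omega
        simp [letter, h, h']
    · simp
  · rw [Finset.prod_eq_single ⟨i, hid⟩]
    · simp [letter]
    · intro b _ hb
      rw [Ne, Fin.ext_iff] at hb
      by_cases h : (b : ℕ) < i
      · have h' : (b : ℕ) < i + 1 := by omega
        simp [letter, h, h']
      · have h' : ¬ (b : ℕ) < i + 1 := by simp at hb; omega
        simp [letter, h', not_lt.1 h]
    · simp
  · intro L _ _ f hf hf₁
    have hx : ∀ a : Fin d, (a : ℕ) < i → f (a, 0) = 1 := fun a ha => by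
      simpa [letter, ha] using hf₁ a
    have hz : ∀ a : Fin d, i ≤ (a : ℕ) → f (a, 2) = 1 := fun a ha => by
      simpa [letter, not_lt.2 ha] using hf₁ a
    have hy := hf.y_eq_zero hi hid hx hz
    obtain ⟨m, rfl⟩ : ∃ m, i = m + 1 := ⟨i - 1, by omega⟩
    obtain ⟨Θ, hs, ht⟩ := hlift L (f (⟨m, by omega⟩, 2)) (f (⟨m + 1, hid⟩, 0)) (hf m hid).2.2
    refine ⟨Θ, ?_⟩
    rintro ⟨⟨n, hn⟩, e⟩
    fin_cases e
    · rcases lt_trichotomy n (m + 1) with h | rfl | h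
      · simp [h, hx ⟨n, hn⟩ h]
      · simp [ht]
      · obtain ⟨r, rfl⟩ : ∃ r, n = r + 1 := ⟨n - 1, by omega⟩
        have h0 := (hf r hn).2.2
        rw [hz ⟨r, _⟩ (by simp; omega), one_mul] at h0
        simp [h0, h.not_gt, show r ≠ m by omega]
    · simp [hy]
    · rcases lt_trichotomy n m with h | rfl | h
      · have h0 := (hf n (by omega)).2.2
        rw [hx ⟨n + 1, _⟩ (by simp; omega), mul_one] at h0
        have h' : ¬ m + 1 ≤ n := by omega
        simp [h0, h', h.ne]
      · simp [hs]
      · have h' : m + 1 ≤ n := h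
        simp [hz ⟨n, hn⟩ h', h']

theorem statement_11 (k : Type) [Field k] (d : ℕ) (hd : 2 ≤ d)
    (w : Sd k d ⧸ KK k d)
    (hw : (∃ i : ℕ, i ≤ d ∧ w = mm k d i 0) ∨ w = mm k d 0 d) :
    Nonempty (degZeroLoc k d w ≃ₐ[k] NodalRing k) := by
  rcases hw with ⟨i, hi, rfl⟩ | rfl
  · rcases Nat.eq_zero_or_pos i with rfl | h0
    · exact nonempty_degZeroLoc_algEquiv_z k hd
    · rcases hi.eq_or_lt with rfl | hlt
      · exact nonempty_degZeroLoc_algEquiv_x k hd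
      · exact nonempty_degZeroLoc_algEquiv_xz k h0 hlt
  · exact nonempty_degZeroLoc_algEquiv_y k hd
end

section
/- Let k be a field and d ≥ 2. Let B denote the k-subalgebra of the quotient ring k[x_i, z_i : 0 ≤ i ≤ d−1]/(z_i x_{i+1} : 0 ≤ i ≤ d−2) generated by the d+1 monomial classes M_i = x_0 x_1 ⋯ x_{i−1} · z_i z_{i+1} ⋯ z_{d−1} for 0 ≤ i ≤ d. Then there is an isomorphism of graded k-algebras B ≅ k[T_0, T_1, …, T_d]/(T_i T_j : j > i+1), where each T_i has degree 1 and each M_i has degree 1. -/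
/-!
Statement 12: Let `B` be the `k`-subalgebra of
`k[x_i, z_i : 0 ≤ i ≤ d−1]/(z_i x_{i+1} : 0 ≤ i ≤ d−2)` generated by the `d+1`
monomial classes `M_i = x_0 ⋯ x_{i−1} · z_i ⋯ z_{d−1}` (`0 ≤ i ≤ d`).  Then
`B ≅ k[T_0, …, T_d]/(T_i T_j : j > i + 1)` as graded `k`-algebras, each `T_i`
and each `M_i` having degree `1` (the isomorphism matches the degree-one
generator `M_i` with the degree-one generator `T_i`).
-/

open MvPolynomial

noncomputable section

variable (k : Type) [Field k] (d : ℕ)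

/-- `k[x_i, z_i : 0 ≤ i ≤ d-1]`, with `x_i = X (i,0)` and `z_i = X (i,1)`. -/
abbrev Pd := MvPolynomial (Fin d × Fin 2) k

/-- the ideal `(z_i x_{i+1} : 0 ≤ i ≤ d-2)` -/
def ZX : Ideal (Pd k d) :=
  Ideal.span {p | ∃ (i : ℕ) (h : i + 1 < d),
    p = X (⟨i, by omega⟩, 1) * X (⟨i + 1, h⟩, 0)}

/-- `M_i = x_0 ⋯ x_{i−1} · z_i ⋯ z_{d−1}` in the quotient. -/
def Mi (i : ℕ) : Pd k d ⧸ ZX k d :=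
  Ideal.Quotient.mk (ZX k d)
    (∏ t : Fin d, if (t : ℕ) < i then X (t, 0) else X (t, 1))

/-- the subalgebra `B` generated by the classes `M_0, …, M_d` -/
def Bsub : Subalgebra k (Pd k d ⧸ ZX k d) :=
  Algebra.adjoin k {q | ∃ i : ℕ, i ≤ d ∧ q = Mi k d i}

/-- `k[T_0, …, T_d]/(T_i T_j : j > i+1)`. -/
def Target := MvPolynomial (Fin (d + 1)) k ⧸
  (Ideal.span {p : MvPolynomial (Fin (d + 1)) k |
    ∃ i j : Fin (d + 1), (i : ℕ) + 1 < (j : ℕ) ∧ p = X i * X j})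

instance : CommRing (Target k d) := by unfold Target; infer_instance
instance : Algebra k (Target k d) := by unfold Target; infer_instance

end

/-- The exponent vector of `M_i`. -/
noncomputable def genExponent (d i : ℕ) : Fin d × Fin 2 →₀ ℕ :=
  Finsupp.equivFunOnFinite.symm fun q => if (q.1 : ℕ) < i ↔ q.2 = 0 then 1 else 0

/-- The exponent vector of the image of the monomial `T ^ a` under `T_i ↦ M_i`. -/
noncomputable def imageExponent (d : ℕ) (a : Fin (d + 1) →₀ ℕ) : Fin d × Fin 2 →₀ ℕ :=
  ∑ i, a i • genExponent d i

theorem imageExponent_zero (d : ℕ) (a : Fin (d + 1) →₀ ℕ) (t : Fin d) :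
    imageExponent d a (t, 0) = ∑ i : Fin (d + 1), if (t : ℕ) < i then a i else 0 := by
  simp [imageExponent, genExponent, Finsupp.finsetSum_apply]

theorem imageExponent_one (d : ℕ) (a : Fin (d + 1) →₀ ℕ) (t : Fin d) :
    imageExponent d a (t, 1) = ∑ i : Fin (d + 1), if (i : ℕ) < t + 1 then a i else 0 := by
  simp [imageExponent, genExponent, Finsupp.finsetSum_apply]

theorem imageExponent_injective {d : ℕ} (hd : 0 < d) :
    Function.Injective (imageExponent d) := by
  intro a b hab
  have partialSum : ∀ n ≤ d + 1, (∑ i : Fin (d + 1), if (i : ℕ) < n then a i else 0) =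
      ∑ i : Fin (d + 1), if (i : ℕ) < n then b i else 0 := by
    intro n hn
    rcases Nat.eq_zero_or_pos n with rfl | hpos
    · simp
    rcases Nat.lt_or_ge d n with h | h
    · have total : ∀ c : Fin (d + 1) →₀ ℕ,
          (∑ i : Fin (d + 1), if (i : ℕ) < n then c i else 0) =
            imageExponent d c (⟨0, hd⟩, 0) + imageExponent d c (⟨0, hd⟩, 1) := by
        intro c
        rw [imageExponent_zero, imageExponent_one, ← Finset.sum_add_distrib]
        refine Finset.sum_congr rfl fun i _ => ?_
        have := i.isLt
        dsimp only
        split_ifs <;> omega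
      rw [total, total, hab]
    · have := DFunLike.congr_fun hab (⟨n - 1, by omega⟩, 1)
      rw [imageExponent_one, imageExponent_one] at this
      simpa [Nat.sub_add_cancel hpos] using this
  have step : ∀ (c : Fin (d + 1) →₀ ℕ) (j : Fin (d + 1)),
      (∑ i : Fin (d + 1), if (i : ℕ) < j + 1 then c i else 0) =
        (∑ i : Fin (d + 1), if (i : ℕ) < j then c i else 0) + c j := by
    intro c j
    have : c j = ∑ i, if i = j then c i else 0 := by simp
    rw [this, ← Finset.sum_add_distrib]
    refine Finset.sum_congr rfl fun i _ => ?_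
    simp only [Fin.ext_iff]
    split_ifs <;> omega
  ext j
  have h₁ := partialSum (j + 1) (by omega)
  rw [step, step, partialSum j (by omega)] at h₁
  exact Nat.add_left_cancel h₁

section

variable (k : Type) [Field k] (d : ℕ)

/-- The ideal `(T_i T_j : j > i + 1)`. -/
noncomputable def nonadjacentIdeal : Ideal (MvPolynomial (Fin (d + 1)) k) :=
  Ideal.span {p | ∃ i j : Fin (d + 1), (i : ℕ) + 1 < (j : ℕ) ∧ p = X i * X j}

/-- The algebra map `T_i ↦ M_i` into the polynomial ring. -/
noncomputable def liftHom : MvPolynomial (Fin (d + 1)) k →ₐ[k] Pd k d :=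
  aeval fun i => monomial (genExponent d i) 1

theorem mk_monomial_genExponent (i : ℕ) :
    Ideal.Quotient.mk (ZX k d) (monomial (genExponent d i) 1) = Mi k d i := by
  rw [Mi, monomial_eq, Finsupp.prod_fintype _ _ (by simp), Fintype.prod_prod_type]
  simp only [Fin.prod_univ_two, map_one, one_mul]
  congr 1
  refine Finset.prod_congr rfl fun t _ => ?_
  by_cases h : (t : ℕ) < i <;> simp [genExponent, h]

theorem liftHom_monomial (a : Fin (d + 1) →₀ ℕ) (c : k) :
    liftHom k d (monomial a c) = monomial (imageExponent d a) c := by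
  rw [liftHom, aeval_monomial, Finsupp.prod_fintype _ _ (by simp)]
  simp only [monomial_pow, one_pow, ← monomial_sum_one, imageExponent]
  rw [algebraMap_eq, C_mul_monomial, mul_one]

variable {d} in
theorem coeff_liftHom (hd : 0 < d) (p : MvPolynomial (Fin (d + 1)) k)
    (a : Fin (d + 1) →₀ ℕ) :
    coeff (imageExponent d a) (liftHom k d p) = coeff a p := by
  induction p using MvPolynomial.induction_on' with
  | monomial b c =>
    rw [liftHom_monomial, coeff_monomial, coeff_monomial]
    simp only [(imageExponent_injective hd).eq_iff]
  | add p q hp hq => rw [map_add, coeff_add, coeff_add, hp, hq]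

theorem mem_ZX_iff (p : Pd k d) :
    p ∈ ZX k d ↔ ∀ m ∈ p.support, ∃ (t : ℕ) (h : t + 1 < d),
      m (⟨t, by omega⟩, 1) ≠ 0 ∧ m (⟨t + 1, h⟩, 0) ≠ 0 := by
  have hZX : ZX k d = Ideal.span ((fun s => monomial s (1 : k)) ''
      {s | ∃ (t : ℕ) (h : t + 1 < d), s = Finsupp.single ((⟨t, by omega⟩ : Fin d), (1 : Fin 2)) 1 +
        Finsupp.single (⟨t + 1, h⟩, 0) 1}) := by
    rw [ZX]
    congr 1
    ext q
    constructor
    · rintro ⟨t, h, rfl⟩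
      exact ⟨_, ⟨t, h, rfl⟩, by simp [X, monomial_mul]⟩
    · rintro ⟨_, ⟨t, h, rfl⟩, rfl⟩
      exact ⟨t, h, by simp [X, monomial_mul]⟩
  rw [hZX, mem_ideal_span_monomial_image]
  refine forall₂_congr fun m _ => ?_
  constructor
  · rintro ⟨_, ⟨t, h, rfl⟩, hle⟩
    refine ⟨t, h, ?_, ?_⟩
    · have := hle (⟨t, by omega⟩, 1)
      simp at this
      omega
    · have := hle (⟨t + 1, h⟩, 0)
      simp at this
      omega
  · rintro ⟨t, h, h₁, h₀⟩
    refine ⟨_, ⟨t, h, rfl⟩, fun q => ?_⟩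
    rw [Finsupp.add_apply, Finsupp.single_apply, Finsupp.single_apply]
    split_ifs with e₁ e₀ e₀
    · exact absurd (e₁.trans e₀.symm) (by simp)
    · subst e₁; omega
    · subst e₀; omega
    · omega

theorem mem_nonadjacentIdeal_iff (p : MvPolynomial (Fin (d + 1)) k) :
    p ∈ nonadjacentIdeal k d ↔ ∀ a ∈ p.support, ∃ i j : Fin (d + 1),
      (i : ℕ) + 1 < j ∧ a i ≠ 0 ∧ a j ≠ 0 := by
  have hJ : nonadjacentIdeal k d = Ideal.span ((fun s => monomial s (1 : k)) ''
      {s | ∃ i j : Fin (d + 1), (i : ℕ) + 1 < j ∧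
        s = Finsupp.single i 1 + Finsupp.single j 1}) := by
    rw [nonadjacentIdeal]
    congr 1
    ext q
    constructor
    · rintro ⟨i, j, h, rfl⟩
      exact ⟨_, ⟨i, j, h, rfl⟩, by simp [X, monomial_mul]⟩
    · rintro ⟨_, ⟨i, j, h, rfl⟩, rfl⟩
      exact ⟨i, j, h, by simp [X, monomial_mul]⟩
  rw [hJ, mem_ideal_span_monomial_image]
  refine forall₂_congr fun a _ => ?_
  constructor
  · rintro ⟨_, ⟨i, j, h, rfl⟩, hle⟩
    refine ⟨i, j, h, ?_, ?_⟩
    · have := hle i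
      simp at this
      omega
    · have := hle j
      simp at this
      omega
  · rintro ⟨i, j, h, h₁, h₀⟩
    refine ⟨_, ⟨i, j, h, rfl⟩, fun q => ?_⟩
    rw [Finsupp.add_apply, Finsupp.single_apply, Finsupp.single_apply]
    split_ifs with e₁ e₀ e₀
    · exact absurd (e₁.trans e₀.symm) (by rintro rfl; omega)
    · subst e₁; omega
    · subst e₀; omega
    · omega

theorem imageExponent_mem_iff (a : Fin (d + 1) →₀ ℕ) :
    (∃ (t : ℕ) (h : t + 1 < d), imageExponent d a (⟨t, by omega⟩, 1) ≠ 0 ∧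
      imageExponent d a (⟨t + 1, h⟩, 0) ≠ 0) ↔
    ∃ i j : Fin (d + 1), (i : ℕ) + 1 < j ∧ a i ≠ 0 ∧ a j ≠ 0 := by
  simp only [imageExponent_zero, imageExponent_one, ne_eq, Finset.sum_eq_zero_iff,
    Finset.mem_univ, true_imp_iff, not_forall, ite_eq_right_iff, exists_prop]
  constructor
  · rintro ⟨t, h, ⟨i, hi, ai⟩, ⟨j, hj, aj⟩⟩
    exact ⟨i, j, by omega, ai, aj⟩
  · rintro ⟨i, j, h, ai, aj⟩
    exact ⟨i, by omega, ⟨i, by omega, ai⟩, ⟨j, h, aj⟩⟩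

variable {d} in
theorem liftHom_mem_ZX_iff (hd : 0 < d) (p : MvPolynomial (Fin (d + 1)) k) :
    liftHom k d p ∈ ZX k d ↔ p ∈ nonadjacentIdeal k d := by
  constructor
  · rw [mem_ZX_iff, mem_nonadjacentIdeal_iff]
    intro h a ha
    refine (imageExponent_mem_iff d a).1 (h _ ?_)
    rwa [mem_support_iff, coeff_liftHom k hd, ← mem_support_iff]
  · intro h
    rw [mem_nonadjacentIdeal_iff] at h
    rw [p.as_sum, map_sum]
    refine Ideal.sum_mem _ fun a ha => ?_
    rw [liftHom_monomial, mem_ZX_iff]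
    intro m hm
    rw [Finset.mem_singleton.1 (support_monomial_subset hm)]
    exact (imageExponent_mem_iff d a).2 (h a ha)

/-- The algebra map `T_i ↦ M_i` into the quotient ring. -/
noncomputable def genHom : MvPolynomial (Fin (d + 1)) k →ₐ[k] Pd k d ⧸ ZX k d :=
  (Ideal.Quotient.mkₐ k (ZX k d)).comp (liftHom k d)

theorem genHom_X (i : Fin (d + 1)) : genHom k d (X i) = Mi k d i := by
  rw [← mk_monomial_genExponent]
  simp [genHom, liftHom]

theorem range_genHom : (genHom k d).range = Bsub k d := by
  rw [← Algebra.map_top, ← MvPolynomial.adjoin_range_X, AlgHom.map_adjoin, Bsub]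
  congr 1
  ext q
  constructor
  · rintro ⟨_, ⟨i, rfl⟩, rfl⟩
    exact ⟨i, by omega, genHom_X k d i⟩
  · rintro ⟨i, h, rfl⟩
    exact ⟨_, ⟨⟨i, by omega⟩, rfl⟩, genHom_X k d _⟩

variable {d} in
theorem ker_genHom (hd : 0 < d) : RingHom.ker (genHom k d) = nonadjacentIdeal k d := by
  ext p
  rw [RingHom.mem_ker, ← liftHom_mem_ZX_iff k hd, ← Ideal.Quotient.eq_zero_iff_mem]
  rfl

variable {d} in
/-- The isomorphism `k[T_0, …, T_d]/(T_i T_j : j > i + 1) ≃ B`. -/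
noncomputable def targetEquiv (hd : 0 < d) :
    (MvPolynomial (Fin (d + 1)) k ⧸ nonadjacentIdeal k d) ≃ₐ[k] Bsub k d :=
  (Ideal.quotientEquivAlgOfEq k (ker_genHom k hd).symm).trans <|
    (Ideal.quotientKerEquivRange (genHom k d)).trans <|
      Subalgebra.equivOfEq _ _ (range_genHom k d)

variable {d} in
theorem coe_targetEquiv_mk (hd : 0 < d) (p : MvPolynomial (Fin (d + 1)) k) :
    (targetEquiv k hd (Ideal.Quotient.mk _ p) : Pd k d ⧸ ZX k d) = genHom k d p :=
  rfl

end

theorem statement_12 (k : Type) [Field k] (d : ℕ) (hd : 2 ≤ d) :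
    ∃ e : Bsub k d ≃ₐ[k] Target k d,
      ∀ (i : ℕ) (h : i ≤ d),
        e ⟨Mi k d i, Algebra.subset_adjoin ⟨i, h, rfl⟩⟩ =
          Ideal.Quotient.mk _ (MvPolynomial.X ⟨i, by omega⟩) := by
  have hd' : 0 < d := by omega
  refine ⟨(targetEquiv k hd').symm, fun i h => ?_⟩
  refine (targetEquiv k hd').symm_apply_eq.2 (Subtype.ext ?_)
  exact ((coe_targetEquiv_mk k hd' (X ⟨i, by omega⟩)).trans (genHom_X k d _)).symm
end

section
/- Let k be a field with char k ≠ 2, let V be a 3-dimensional k-vector space with basis x, y, z, and let I be the two-sided ideal of the tensor algebra T(V) generated by the degree-2 elements x⊗x − x⊗y, y⊗x, z⊗x − x⊗z − z⊗z, and z⊗y − y⊗z. For d ≥ 0 let I_d = I ∩ V^{⊗d} and let A_d = V^{⊗d}/I_d be the degree-d component of A = T(V)/I. Then dim_k A_0 = 1, dim_k A_1 = 3, dim_k A_2 = 5, dim_k A_3 = 4, and dim_k A_d = 2 for all d ≥ 4; explicitly, the images of the words 1, x, x^2, xz, zx, x^2z, xzx together with y^n and y^{n−1}z (n ≥ 1)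 form a k-basis of A. Equivalently, the Hilbert series of A is 1 + 3t + 5t^2 + 4t^3 + 2t^4/(1−t). -/
/-!
Statement 19: Let `char k ≠ 2` and let
`A = k⟨x,y,z⟩/⟨x²−xy, yx, zx−xz−z², zy−yz⟩ = T(V)/I` where `V` is the span of
the generators `x, y, z` of the free algebra (tensor algebra) `T(V) = k⟨x,y,z⟩`
and `I` is the two-sided ideal generated by the four listed degree-2 elements.
With `T(V)_e = (span{x,y,z})^e` the degree-`e` component and
`I_e = I ∩ T(V)_e`, the degree-`e` component of `A` is `A_e = T(V)_e / I_e`,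
and `dim_k A_0 = 1`, `dim_k A_1 = 3`, `dim_k A_2 = 5`, `dim_k A_3 = 4`, and
`dim_k A_e = 2` for all `e ≥ 4`; i.e. the Hilbert series of `A` is
`1 + 3t + 5t² + 4t³ + 2t⁴/(1−t)`.
-/

noncomputable section

variable (k : Type) [Field k]

/-- the free algebra `k⟨x,y,z⟩ = T(V)` for `V` three-dimensional with basis
`x, y, z` -/
abbrev FA := FreeAlgebra k (Fin 3)

def xg : FA k := FreeAlgebra.ι k 0
def yg : FA k := FreeAlgebra.ι k 1
def zg : FA k := FreeAlgebra.ι k 2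

/-- the two-sided ideal `I` generated by
`x²−xy, yx, zx−xz−z², zy−yz`, as a `k`-submodule of `T(V)` -/
def Irel : Submodule k (FA k) :=
  Submodule.span k {p | ∃ a b : FA k,
    p = a * (xg k * xg k - xg k * yg k) * b ∨
    p = a * (yg k * xg k) * b ∨
    p = a * (zg k * xg k - xg k * zg k - zg k * zg k) * b ∨
    p = a * (zg k * yg k - yg k * zg k) * b}

/-- the degree-`e` component `T(V)_e = V^{⊗e}` of the tensor algebra, where
`V = span{x,y,z}` -/
def Wdeg (e : ℕ) : Submodule k (FA k) :=
  (Submodule.span k (Set.range (FreeAlgebra.ι k)) : Submodule k (FA k)) ^ e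

/-- the degree-`e` component `A_e = V^{⊗e}/I_e` of `A = T(V)/I`, where
`I_e = I ∩ V^{⊗e}` -/
def Adeg (e : ℕ) :=
  ↥(Wdeg k e) ⧸ Submodule.comap (Wdeg k e).subtype (Irel k)

instance (e : ℕ) : AddCommGroup (Adeg k e) := by unfold Adeg; infer_instance
instance (e : ℕ) : Module k (Adeg k e) := by unfold Adeg; infer_instance

end

noncomputable section

lemma mul_mem_Irel_left (k : Type) [Field k] (c : FA k) {p : FA k} (hp : p ∈ Irel k) :
    c * p ∈ Irel k := by
  refine Submodule.span_induction ?_ (by simp) (fun u v _ _ hu hv => ?_)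
    (fun r u _ hu => ?_) hp
  · rintro p ⟨a, b, h⟩
    refine Submodule.subset_span ⟨c * a, b, ?_⟩
    rcases h with h | h | h | h <;> simp [h, mul_assoc]
  · rw [mul_add]; exact add_mem hu hv
  · rw [mul_smul_comm]; exact Submodule.smul_mem _ r hu

lemma mul_mem_Irel_right (k : Type) [Field k] (c : FA k) {p : FA k} (hp : p ∈ Irel k) :
    p * c ∈ Irel k := by
  refine Submodule.span_induction ?_ (by simp) (fun u v _ _ hu hv => ?_)
    (fun r u _ hu => ?_) hp
  · rintro p ⟨a, b, h⟩
    refine Submodule.subset_span ⟨a, b * c, ?_⟩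
    rcases h with h | h | h | h <;> simp [h, mul_assoc]
  · rw [add_mul]; exact add_mem hu hv
  · rw [smul_mul_assoc]; exact Submodule.smul_mem _ r hu

/-- The submodule `Irel k` as an ideal of the free algebra. -/
def relIdeal (k : Type) [Field k] : Ideal (FA k) where
  carrier := Irel k
  add_mem' := add_mem
  zero_mem' := zero_mem _
  smul_mem' c _ hp := mul_mem_Irel_left k c hp

instance (k : Type) [Field k] : (relIdeal k).IsTwoSided where
  mul_mem_of_left c hp := mul_mem_Irel_right k c hp

/-- The quotient algebra `T(V)/I`. -/
abbrev QA (k : Type) [Field k] := FA k ⧸ relIdeal k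

/-- The quotient map `T(V) → T(V)/I`. -/
def toQA (k : Type) [Field k] : FA k →ₐ[k] QA k := Ideal.Quotient.mkₐ k (relIdeal k)

lemma toQA_eq_zero_iff (k : Type) [Field k] (p : FA k) : toQA k p = 0 ↔ p ∈ Irel k :=
  Ideal.Quotient.eq_zero_iff_mem

/-- Elements `x, y, z` of an algebra subject to the defining relations of `T(V)/I`. -/
structure QuadRel {R : Type*} [Ring R] (x y z : R) : Prop where
  xy : x * y = x * x
  yx : y * x = 0
  zz : z * z = z * x - x * z
  zy : z * y = y * z

namespace QuadRel

variable {R : Type*} [Ring R] {x y z : R}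

lemma yzx (h : QuadRel x y z) : y * z * x = 0 := by
  rw [← h.zy, mul_assoc, h.yx, mul_zero]

lemma yzz (h : QuadRel x y z) : y * z * z = 0 := by
  rw [mul_assoc, h.zz, mul_sub, ← mul_assoc, h.yzx, ← mul_assoc, h.yx, zero_mul, sub_zero]

lemma xxx (h : QuadRel x y z) : x * x * x = 0 := by
  rw [← h.xy, mul_assoc, h.yx, mul_zero]

lemma xxy (h : QuadRel x y z) : x * x * y = 0 := by
  rw [mul_assoc, h.xy, ← mul_assoc, h.xxx]

lemma zxx (h : QuadRel x y z) : z * x * x = x * x * z := by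
  have h1 : z * z * y = 0 := by rw [mul_assoc, h.zy, ← mul_assoc, h.zy, h.yzz]
  rw [h.zz, sub_mul, sub_eq_zero] at h1
  rw [mul_assoc, ← h.xy, ← mul_assoc, h1, mul_assoc, h.zy, ← mul_assoc, h.xy]

lemma zxy (h : QuadRel x y z) : z * x * y = x * x * z := by
  rw [mul_assoc, h.xy, ← mul_assoc, h.zxx]

lemma xzy (h : QuadRel x y z) : x * z * y = x * x * z := by
  rw [mul_assoc, h.zy, ← mul_assoc, h.xy]

lemma xzz (h : QuadRel x y z) : x * z * z = x * z * x - x * x * z := by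
  rw [mul_assoc, h.zz, mul_sub]; noncomm_ring

lemma zxz {k : Type*} [Field k] [Algebra k R] (hk : (2 : k) ≠ 0) (h : QuadRel x y z) :
    z * x * z = 0 := by
  have h1 : z * z * z = z * (z * z) := mul_assoc _ _ _
  have h2 : z * (z * z) = z * z * x - z * x * z := by
    nth_rw 1 [h.zz]; noncomm_ring
  rw [h2, h.zz, sub_mul, sub_mul, h.zxx, h.xzz] at h1
  have h3 : (2 : k) • (z * x * z) = 0 := by
    rw [two_smul]
    calc z * x * z + z * x * z
        = (z * x * z - (x * z * x - x * x * z)) - (x * x * z - x * z * x - z * x * z) := by abel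
      _ = 0 := sub_eq_zero.mpr h1
  exact (smul_eq_zero.mp h3).resolve_left hk

lemma xxzx (h : QuadRel x y z) :
    x * x * z * x = 0 := by
  rw [← h.zxx, mul_assoc z, mul_assoc z, h.xxx, mul_zero]

lemma xxzy (h : QuadRel x y z) : x * x * z * y = 0 := by
  rw [mul_assoc, h.zy, ← mul_assoc, h.xxy, zero_mul]

lemma xxzz (h : QuadRel x y z) : x * x * z * z = 0 := by
  rw [← h.xy, mul_assoc x, mul_assoc x, h.yzz, mul_zero]

lemma xzxx (h : QuadRel x y z) : x * z * x * x = 0 := by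
  rw [mul_assoc x, mul_assoc x, h.zxx, ← mul_assoc, ← mul_assoc, h.xxx, zero_mul]

lemma xzxy (h : QuadRel x y z) : x * z * x * y = 0 := by
  rw [mul_assoc, h.xy, ← mul_assoc, h.xzxx]

end QuadRel

section Powers

open scoped Pointwise

variable {k R : Type*} [Field k] [Ring R] [Algebra k R] {x y z : R}

/-- A spanning set of `M ^ n` determines one of `M ^ (n + 1)` once products with generators of
`M` have been reduced. -/
lemma span_pow_succ_eq_span {G S T : Set R} {n : ℕ}
    (hS : Submodule.span k G ^ n = Submodule.span k S)
    (hle : ∀ u ∈ S, ∀ v ∈ G, u * v ∈ Submodule.span k T) (hT : T ⊆ S * G) :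
    Submodule.span k G ^ (n + 1) = Submodule.span k T := by
  rw [pow_succ, hS, Submodule.span_mul_span]
  refine le_antisymm (Submodule.span_le.mpr ?_) (Submodule.span_mono hT)
  rintro _ ⟨u, hu, v, hv, rfl⟩
  exact hle u hu v hv

namespace QuadRel

lemma span_sq (h : QuadRel x y z) :
    Submodule.span k {x, y, z} ^ 2 =
      Submodule.span k {x * x, x * z, z * x, y * y, y * z} := by
  refine span_pow_succ_eq_span (S := {x, y, z}) (pow_one _) ?_ ?_
  · have hs : ∀ u ∈ ({x * x, x * z, z * x, y * y, y * z} : Set R),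
        u ∈ Submodule.span k {x * x, x * z, z * x, y * y, y * z} :=
      fun u hu => Submodule.subset_span hu
    simp only [Set.mem_insert_iff, Set.mem_singleton_iff, forall_eq_or_imp, forall_eq] at hs ⊢
    simp [h.xy, h.yx, h.zz, h.zy, hs, sub_mem]
  · rintro _ (rfl | rfl | rfl | rfl | rfl) <;> exact Set.mul_mem_mul (by simp) (by simp)

lemma span_cube (hk : (2 : k) ≠ 0) (h : QuadRel x y z) :
    Submodule.span k {x, y, z} ^ 3 =
      Submodule.span k {x * x * z, x * z * x, y * y * y, y * y * z} := by
  refine span_pow_succ_eq_span h.span_sq ?_ ?_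
  · have hs : ∀ u ∈ ({x * x * z, x * z * x, y * y * y, y * y * z} : Set R),
        u ∈ Submodule.span k {x * x * z, x * z * x, y * y * y, y * y * z} :=
      fun u hu => Submodule.subset_span hu
    simp only [Set.mem_insert_iff, Set.mem_singleton_iff, forall_eq_or_imp, forall_eq] at hs ⊢
    have hyyx : y * y * x = 0 := by rw [mul_assoc, h.yx, mul_zero]
    have hyzy : y * z * y = y * y * z := by rw [mul_assoc, h.zy, mul_assoc]
    simp [h.xxx, h.xxy, h.xzy, h.xzz, h.zxx, h.zxy, h.zxz hk, hyyx, h.yzx, hyzy, h.yzz, hs, sub_mem]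
  · rintro _ (rfl | rfl | rfl | rfl) <;> exact Set.mul_mem_mul (by simp) (by simp)

lemma span_pow (hk : (2 : k) ≠ 0) (h : QuadRel x y z) (n : ℕ) :
    Submodule.span k {x, y, z} ^ (n + 4) =
      Submodule.span k {y ^ (n + 4), y ^ (n + 3) * z} := by
  have hx (m : ℕ) : y ^ (m + 1) * x = 0 := by rw [pow_succ, mul_assoc, h.yx, mul_zero]
  have hzx (m : ℕ) : y ^ (m + 1) * z * x = 0 := by
    rw [pow_succ, mul_assoc _ y z, mul_assoc, h.yzx, mul_zero]
  have hzy (m : ℕ) : y ^ m * z * y = y ^ (m + 1) * z := by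
    rw [mul_assoc, h.zy, ← mul_assoc, pow_succ]
  have hzz (m : ℕ) : y ^ (m + 1) * z * z = 0 := by
    rw [pow_succ, mul_assoc _ y z, mul_assoc, h.yzz, mul_zero]
  have hs (m : ℕ) : ∀ u ∈ ({y ^ (m + 1), y ^ m * z} : Set R),
      u ∈ Submodule.span k {y ^ (m + 1), y ^ m * z} :=
    fun u hu => Submodule.subset_span hu
  simp only [Set.mem_insert_iff, Set.mem_singleton_iff, forall_eq_or_imp, forall_eq] at hs
  induction n with
  | zero =>
    refine span_pow_succ_eq_span (h.span_cube hk) ?_ ?_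
    · have hxzxz : x * z * x * z = 0 := by rw [mul_assoc x, mul_assoc x, h.zxz hk, mul_zero]
      simp only [Set.mem_insert_iff, Set.mem_singleton_iff, forall_eq_or_imp, forall_eq,
        ← pow_two]
      simp only [pow_two x, h.xxzx, h.xxzy, h.xxzz, h.xzxx, h.xzxy, hxzxz, hx, hzx, hzy, hzz,
        ← pow_succ, zero_mem, hs, and_self]
    · rintro _ (rfl | rfl)
      · exact ⟨y * y * y, by simp, y, by simp, by noncomm_ring⟩
      · exact ⟨y * y * y, by simp, z, by simp, by noncomm_ring⟩
  | succ n ih =>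
    refine span_pow_succ_eq_span ih ?_ ?_
    · simp only [Set.mem_insert_iff, Set.mem_singleton_iff, forall_eq_or_imp, forall_eq, hx, hzx,
        hzy, hzz, ← pow_succ, zero_mem, hs, and_self]
    · rintro _ (rfl | rfl)
      · exact ⟨y ^ (n + 4), by simp, y, by simp, (pow_succ _ _).symm⟩
      · exact ⟨y ^ (n + 4), by simp, z, by simp, rfl⟩

end QuadRel

end Powers

lemma quadRel_toQA (k : Type) [Field k] :
    QuadRel (toQA k (xg k)) (toQA k (yg k)) (toQA k (zg k)) := by
  constructor <;> simp only [← map_mul, ← map_sub] <;>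
    (try rw [← sub_eq_zero, ← map_sub]) <;> rw [toQA_eq_zero_iff]
  · rw [← neg_sub]
    exact neg_mem (Submodule.subset_span ⟨1, 1, .inl (by simp)⟩)
  · exact Submodule.subset_span ⟨1, 1, .inr (.inl (by simp))⟩
  · rw [← neg_sub]
    exact neg_mem (Submodule.subset_span ⟨1, 1, .inr (.inr (.inl (by simp)))⟩)
  · exact Submodule.subset_span ⟨1, 1, .inr (.inr (.inr (by simp)))⟩

lemma map_toQA_Wdeg (k : Type) [Field k] (e : ℕ) :
    (Wdeg k e).map (toQA k).toLinearMap =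
      Submodule.span k {toQA k (xg k), toQA k (yg k), toQA k (zg k)} ^ e := by
  rw [Wdeg, Submodule.map_pow, Submodule.map_span, ← Set.range_comp]
  congr 2
  ext u
  simp [Fin.exists_fin_succ, xg, yg, zg, eq_comm]

lemma finrank_Adeg (k : Type) [Field k] (e : ℕ) :
    Module.finrank k (Adeg k e) =
      Module.finrank k ↥(Submodule.span k
        {toQA k (xg k), toQA k (yg k), toQA k (zg k)} ^ e) := by
  let f : ↥(Wdeg k e) →ₗ[k] QA k := (toQA k).toLinearMap ∘ₗ (Wdeg k e).subtype
  have hker : LinearMap.ker f = Submodule.comap (Wdeg k e).subtype (Irel k) := by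
    ext p
    simp [f, toQA_eq_zero_iff]
  have hrange : LinearMap.range f =
      Submodule.span k {toQA k (xg k), toQA k (yg k), toQA k (zg k)} ^ e := by
    rw [LinearMap.range_comp, Submodule.range_subtype, map_toQA_Wdeg]
  rw [← hrange, ← f.quotKerEquivRange.finrank_eq, hker]
  rfl

/-- An algebra homomorphism out of `T(V)` respecting the relations kills `I`. -/
lemma lift_eq_zero_of_mem_Irel {k : Type} [Field k] {B : Type*} [Ring B] [Algebra k B]
    (f : Fin 3 → B) (h : QuadRel (f 0) (f 1) (f 2)) {p : FA k} (hp : p ∈ Irel k) :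
    FreeAlgebra.lift k f p = 0 := by
  suffices Irel k ≤ LinearMap.ker (FreeAlgebra.lift k f).toLinearMap from this hp
  refine Submodule.span_le.mpr ?_
  rintro p ⟨a, b, rfl | rfl | rfl | rfl⟩ <;>
    simp [xg, yg, zg, h.xy, h.yx, h.zz, h.zy]

/-- The representation of `T(V)/I` with `x ↦ 0`, detecting the words `yⁿ` and `yⁿ⁻¹z`. -/
def polyRep (k : Type) [Field k] : Fin 3 → Matrix (Fin 2) (Fin 2) (Polynomial k) :=
  ![0, !![Polynomial.X, 0; 0, Polynomial.X], !![0, Polynomial.X; 0, 0]]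

lemma quadRel_polyRep (k : Type) [Field k] :
    QuadRel (polyRep k 0) (polyRep k 1) (polyRep k 2) := by
  constructor <;> ext i j <;> fin_cases i <;> fin_cases j <;> simp [polyRep]

/-- A representation of `T(V)/I` on a cyclic module with top degree detected by `x²z`. -/
def xxzRep (k : Type) [Field k] : Fin 3 → Matrix (Fin 7) (Fin 7) k :=
  ![!![0, 0, 0, 0, 0, 0, 0;
       1, 0, 0, 0, 0, 0, 0;
       0, 0, 0, 0, 0, 0, 0;
       0, 0, 0, 0, 0, 0, 0;
       0, 0, 0, 1, 0, 0, 0;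
       0, 1, 1, 0, 0, 0, 0;
       0, 0, 0, 0, 1, 0, 0],
    !![0, 0, 0, 0, 0, 0, 0;
       0, 0, 0, 0, 0, 0, 0;
       1, 0, 0, 0, 0, 0, 0;
       0, 0, 0, 0, 0, 0, 0;
       0, 0, 0, 1, 0, 0, 0;
       0, 0, 0, 0, 0, 0, 0;
       0, 0, 0, 0, 0, 0, 0],
    !![0, 0, 0, 0, 0, 0, 0;
       0, 0, 0, 0, 0, 0, 0;
       0, 0, 0, 0, 0, 0, 0;
       1, 0, 0, 0, 0, 0, 0;
       0, 0, 1, -1, 0, 0, 0;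
       0, 1, 0, 1, 0, 0, 0;
       0, 0, 0, 0, 0, 1, 0]]

set_option maxHeartbeats 2000000 in
lemma quadRel_xxzRep (k : Type) [Field k] :
    QuadRel (xxzRep k 0) (xxzRep k 1) (xxzRep k 2) := by
  constructor <;> ext i j <;> fin_cases i <;> fin_cases j <;>
    simp [xxzRep, Matrix.mul_apply, Fin.sum_univ_seven]

/-- A representation of `T(V)/I` on a cyclic module with top degree detected by `xzx`. -/
def xzxRep (k : Type) [Field k] : Fin 3 → Matrix (Fin 4) (Fin 4) k :=
  ![!![0, 0, 0, 0;
       1, 0, 0, 0;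
       0, 0, 0, 0;
       0, 0, 1, 0],
    0,
    !![0, 0, 0, 0;
       1, 0, 0, 0;
       0, 1, 0, 0;
       0, 0, -1, 0]]

lemma quadRel_xzxRep (k : Type) [Field k] :
    QuadRel (xzxRep k 0) (xzxRep k 1) (xzxRep k 2) := by
  constructor <;> ext i j <;> fin_cases i <;> fin_cases j <;>
    simp [xzxRep, Matrix.mul_apply, Fin.sum_univ_four]


lemma finrank_span_toQA {k : Type} [Field k] {n : ℕ} {S : Set (QA k)} (w : Fin n → FA k)
    (hS : S = Set.range fun i => toQA k (w i))
    (hw : ∀ g : Fin n → k, ∑ i, g i • w i ∈ Irel k → ∀ i, g i = 0) :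
    Module.finrank k (Submodule.span k S) = n := by
  rw [hS, finrank_span_eq_card, Fintype.card_fin]
  refine Fintype.linearIndependent_iff.mpr fun g hg => hw g ?_
  rw [← toQA_eq_zero_iff]
  simpa using hg

lemma finrank_Adeg_zero (k : Type) [Field k] : Module.finrank k (Adeg k 0) = 1 := by
  rw [finrank_Adeg, pow_zero, Submodule.one_eq_span]
  refine finrank_span_singleton fun h => ?_
  rw [← map_one (toQA k), toQA_eq_zero_iff] at h
  simpa using lift_eq_zero_of_mem_Irel _ (quadRel_polyRep k) h

lemma finrank_Adeg_one (k : Type) [Field k] : Module.finrank k (Adeg k 1) = 3 := by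
  rw [finrank_Adeg, pow_one]
  refine finrank_span_toQA ![xg k, yg k, zg k]
    (by ext u; simp [Fin.exists_fin_succ, eq_comm]) fun g hg => ?_
  have hp := lift_eq_zero_of_mem_Irel _ (quadRel_polyRep k) hg
  have hx := congr_fun₂ (lift_eq_zero_of_mem_Irel _ (quadRel_xxzRep k) hg) 1 0
  have hp0 := congr_fun₂ hp 0 0
  have hp1 := congr_fun₂ hp 0 1
  simp [Fin.sum_univ_succ, xg, yg, zg, polyRep, xxzRep] at hp0 hp1 hx
  simp [Fin.forall_fin_succ, *]

lemma finrank_Adeg_two (k : Type) [Field k] : Module.finrank k (Adeg k 2) = 5 := by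
  rw [finrank_Adeg, (quadRel_toQA k).span_sq]
  refine finrank_span_toQA
    ![xg k * xg k, xg k * zg k, zg k * xg k, yg k * yg k, yg k * zg k]
    (by ext u; simp [Fin.exists_fin_succ, eq_comm]) fun g hg => ?_
  have hp := lift_eq_zero_of_mem_Irel _ (quadRel_polyRep k) hg
  have hx := lift_eq_zero_of_mem_Irel _ (quadRel_xxzRep k) hg
  have hz := congr_fun₂ (lift_eq_zero_of_mem_Irel _ (quadRel_xzxRep k) hg) 2 0
  have hp0 := congr_fun₂ hp 0 0
  have hp1 := congr_fun₂ hp 0 1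
  have hx4 := congr_fun₂ hx 4 0
  have hx5 := congr_fun₂ hx 5 0
  simp [Fin.sum_univ_succ, xg, yg, zg, polyRep, xxzRep, xzxRep]
    at hp0 hp1 hx4 hx5 hz
  simp_all [Fin.forall_fin_succ]

lemma finrank_Adeg_three (k : Type) [Field k] (hk : (2 : k) ≠ 0) :
    Module.finrank k (Adeg k 3) = 4 := by
  rw [finrank_Adeg, (quadRel_toQA k).span_cube hk]
  refine finrank_span_toQA
    ![xg k * xg k * zg k, xg k * zg k * xg k, yg k * yg k * yg k, yg k * yg k * zg k]
    (by ext u; simp [Fin.exists_fin_succ, eq_comm]) fun g hg => ?_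
  have hp := lift_eq_zero_of_mem_Irel _ (quadRel_polyRep k) hg
  have hx := congr_fun₂ (lift_eq_zero_of_mem_Irel _ (quadRel_xxzRep k) hg) 6 0
  have hz := congr_fun₂ (lift_eq_zero_of_mem_Irel _ (quadRel_xzxRep k) hg) 3 0
  have hp0 := congr_fun₂ hp 0 0
  have hp1 := congr_fun₂ hp 0 1
  simp [Fin.sum_univ_succ, xg, yg, zg, polyRep, xxzRep, xzxRep]
    at hp0 hp1 hx hz
  simp_all [Fin.forall_fin_succ]

lemma polyRep_one_pow (k : Type) [Field k] (n : ℕ) :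
    polyRep k 1 ^ n = !![Polynomial.X ^ n, 0; 0, Polynomial.X ^ n] := by
  induction n with
  | zero => simp [Matrix.one_fin_two]
  | succ n ih => rw [pow_succ, ih]; simp [polyRep, pow_succ]

lemma finrank_Adeg_of_four_le (k : Type) [Field k] (hk : (2 : k) ≠ 0) (e : ℕ) (he : 4 ≤ e) :
    Module.finrank k (Adeg k e) = 2 := by
  obtain ⟨n, rfl⟩ := Nat.exists_eq_add_of_le' he
  rw [finrank_Adeg, (quadRel_toQA k).span_pow hk]
  refine finrank_span_toQA ![yg k ^ (n + 4), yg k ^ (n + 3) * zg k]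
    (by ext u; simp [Fin.exists_fin_succ, eq_comm]) fun g hg => ?_
  have hp := lift_eq_zero_of_mem_Irel _ (quadRel_polyRep k) hg
  simp only [Fin.sum_univ_two, map_add, map_smul, map_mul, map_pow, yg, zg,
    FreeAlgebra.lift_ι_apply, Matrix.cons_val_zero, Matrix.cons_val_one, polyRep_one_pow] at hp
  have hp0 := congr_fun₂ hp 0 0
  have hp1 := congr_fun₂ hp 0 1
  simp [polyRep] at hp0 hp1
  simp [Fin.forall_fin_succ, *]

end

theorem statement_19 (k : Type) [Field k] (hchar : (2 : k) ≠ 0) :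
    Module.finrank k (Adeg k 0) = 1 ∧
    Module.finrank k (Adeg k 1) = 3 ∧
    Module.finrank k (Adeg k 2) = 5 ∧
    Module.finrank k (Adeg k 3) = 4 ∧
    ∀ e : ℕ, 4 ≤ e → Module.finrank k (Adeg k e) = 2 := by
  exact ⟨finrank_Adeg_zero k, finrank_Adeg_one k, finrank_Adeg_two k,
    finrank_Adeg_three k hchar, finrank_Adeg_of_four_le k hchar⟩
end
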